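/- There is a universal constant K > 0 such that for all N ≥ 1, all β ∈ (0,1], and all t ∈ [0,1], |E⟨R⁻(σ,τ)²⟩_t − E⟨R⁻(σ,τ)²⟩_{t,0}| ≤ K·E⟨R(σ¹,σ²)⁴⟩, where ⟨·⟩ is the Gibbs average of the original single SK system at inverse temperature β. -/

import Mathlib

open MeasureTheory ProbabilityTheory Real Finset Filter

noncomputable section

/-- Spin configurations: each of the `N` sites carries a `±1` spin, encoded by a `Bool`. -/
abbrev Config (N : ℕ) := Fin N → Bool

/-- The `±1` value of a spin. -/
def spin (b : Bool) : ℝ := if b then 1 else -1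

/-- The value of the last spin `σ_N` (junk value `0` when `N = 0`). -/
def spinLast {N : ℕ} (σ : Config N) : ℝ :=
  if h : 0 < N then spin (σ ⟨N - 1, Nat.sub_lt h Nat.one_pos⟩) else 0

/-- The Gaussian disorder: i.i.d. standard Gaussians indexed by pairs `(i, j)`
(only the entries with `i < j` are used). -/
def gaussPi (N : ℕ) : Measure (Fin N × Fin N → ℝ) :=
  Measure.pi fun _ => gaussianReal 0 1

instance (N : ℕ) : IsProbabilityMeasure (gaussPi N) := by
  unfold gaussPi; infer_instance

/-- Three independent copies `g, g', g''` of the disorder. -/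
def disM3 (N : ℕ) :
    Measure ((Fin N × Fin N → ℝ) × (Fin N × Fin N → ℝ) × (Fin N × Fin N → ℝ)) :=
  (gaussPi N).prod ((gaussPi N).prod (gaussPi N))

/-- The SK Hamiltonian `H_{N,β}(σ) = (β/√N) ∑_{i<j} g_{ij} σ_i σ_j`. -/
def ham (N : ℕ) (β : ℝ) (g : Fin N × Fin N → ℝ) (σ : Config N) : ℝ :=
  (β / Real.sqrt N) *
    ∑ p ∈ Finset.univ.filter (fun p : Fin N × Fin N => p.1 < p.2),
      g p * spin (σ p.1) * spin (σ p.2)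

/-- The cavity Hamiltonian `H⁻_N(σ) = (β/√N) ∑_{i<j<N} g_{ij} σ_i σ_j` on the first
`N - 1` spins. -/
def hamCav (N : ℕ) (β : ℝ) (g : Fin N × Fin N → ℝ) (σ : Config N) : ℝ :=
  (β / Real.sqrt N) *
    ∑ p ∈ Finset.univ.filter
        (fun p : Fin N × Fin N => p.1 < p.2 ∧ (p.2 : ℕ) < N - 1),
      g p * spin (σ p.1) * spin (σ p.2)

/-- The overlap `R(σ¹,σ²) = (1/N) ∑_{i ≤ N} σ_i¹ σ_i²`. -/
def ovlp (N : ℕ) (σ τ : Config N) : ℝ := (∑ i, spin (σ i) * spin (τ i)) / N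

/-- The truncated overlap `R⁻(σ¹,σ²) = (1/N) ∑_{i ≤ N−1} σ_i¹ σ_i²`. -/
def ovlpm (N : ℕ) (σ τ : Config N) : ℝ :=
  (∑ i ∈ Finset.univ.filter (fun i : Fin N => (i : ℕ) < N - 1),
    spin (σ i) * spin (τ i)) / N

/-- The partition function `Z_N(β)`. -/
def partFun (N : ℕ) (β : ℝ) (g : Fin N × Fin N → ℝ) : ℝ :=
  ∑ σ : Config N, Real.exp (ham N β g σ)

/-- The free energy `F_N(β) = ln Z_N(β)`. -/
def freeEnergy (N : ℕ) (β : ℝ) (g : Fin N × Fin N → ℝ) : ℝ :=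
  Real.log (partFun N β g)

/-- Two-replica Gibbs average `⟨f⟩` for the single SK system. -/
def gibbs2 (N : ℕ) (β : ℝ) (g : Fin N × Fin N → ℝ)
    (f : Config N → Config N → ℝ) : ℝ :=
  (∑ σ : Config N, ∑ τ : Config N,
    f σ τ * Real.exp (ham N β g σ + ham N β g τ)) / (partFun N β g) ^ 2

/-- Disorder expectation of the two-replica Gibbs average. -/
def Egibbs2 (N : ℕ) (β : ℝ) (f : Config N → Config N → ℝ) : ℝ :=
  ∫ g, gibbs2 N β g f ∂gaussPi N

/-- The interpolated Hamiltonian `√t · H_N + √(1−t) · H'_N`. -/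
def hamT (N : ℕ) (β t : ℝ) (g g' : Fin N × Fin N → ℝ) (σ : Config N) : ℝ :=
  Real.sqrt t * ham N β g σ + Real.sqrt (1 - t) * ham N β g' σ

/-- The coupled Gibbs weight `exp(H¹_{N,t}(σ) + H²_{N,t}(τ))`. -/
def wT (N : ℕ) (β t : ℝ) (g g' g'' : Fin N × Fin N → ℝ)
    (ρ : Config N × Config N) : ℝ :=
  Real.exp (hamT N β t g g' ρ.1 + hamT N β t g g'' ρ.2)

/-- The coupled Gibbs average `⟨f⟩_t` of a function of one pair `(σ, τ)`. -/
def gibbsT (N : ℕ) (β t : ℝ) (g g' g'' : Fin N × Fin N → ℝ)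
    (f : Config N × Config N → ℝ) : ℝ :=
  (∑ ρ : Config N × Config N, f ρ * wT N β t g g' g'' ρ) /
    (∑ ρ : Config N × Config N, wT N β t g g' g'' ρ)

/-- The coupled Gibbs average `⟨f⟩_t` of a function of two pairs. -/
def gibbsT2 (N : ℕ) (β t : ℝ) (g g' g'' : Fin N × Fin N → ℝ)
    (f : Config N × Config N → Config N × Config N → ℝ) : ℝ :=
  (∑ ρ₁ : Config N × Config N, ∑ ρ₂ : Config N × Config N,
    f ρ₁ ρ₂ * wT N β t g g' g'' ρ₁ * wT N β t g g' g'' ρ₂) /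
    (∑ ρ : Config N × Config N, wT N β t g g' g'' ρ) ^ 2

/-- Disorder expectation `E⟨f⟩_t` (one pair). -/
def EgibbsT (N : ℕ) (β t : ℝ) (f : Config N × Config N → ℝ) : ℝ :=
  ∫ ω, gibbsT N β t ω.1 ω.2.1 ω.2.2 f ∂disM3 N

/-- Disorder expectation `E⟨f⟩_t` (two pairs). -/
def EgibbsT2 (N : ℕ) (β t : ℝ)
    (f : Config N × Config N → Config N × Config N → ℝ) : ℝ :=
  ∫ ω, gibbsT2 N β t ω.1 ω.2.1 ω.2.2 f ∂disM3 N

/-- The `s`-dependent cavity field term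
`(β/√N) σ_N ∑_{i<N} (√t g_{iN} + √(1−t) g'_{iN}) σ_i`. -/
def cavField (N : ℕ) (β t : ℝ) (g g' : Fin N × Fin N → ℝ) (σ : Config N) : ℝ :=
  if h : 0 < N then
    (β / Real.sqrt N) * spin (σ ⟨N - 1, Nat.sub_lt h Nat.one_pos⟩) *
      ∑ i ∈ Finset.univ.filter (fun i : Fin N => (i : ℕ) < N - 1),
        (Real.sqrt t * g (i, ⟨N - 1, Nat.sub_lt h Nat.one_pos⟩) +
          Real.sqrt (1 - t) * g' (i, ⟨N - 1, Nat.sub_lt h Nat.one_pos⟩)) * spin (σ i)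
  else 0

/-- The cavity-interpolated Hamiltonian `H^1_{N,t,s}` (resp. `H^2_{N,t,s}` with `g''`). -/
def hamTS (N : ℕ) (β t s : ℝ) (g g' : Fin N × Fin N → ℝ) (σ : Config N) : ℝ :=
  Real.sqrt t * hamCav N β g σ + Real.sqrt (1 - t) * hamCav N β g' σ +
    Real.sqrt s * cavField N β t g g' σ

/-- The coupled cavity Gibbs weight `exp(H¹_{N,t,s}(σ) + H²_{N,t,s}(τ))`. -/
def wTS (N : ℕ) (β t s : ℝ) (g g' g'' : Fin N × Fin N → ℝ)
    (ρ : Config N × Config N) : ℝ :=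
  Real.exp (hamTS N β t s g g' ρ.1 + hamTS N β t s g g'' ρ.2)

/-- The coupled cavity Gibbs average `⟨f⟩_{t,s}` of a function of one pair. -/
def gibbsTS1 (N : ℕ) (β t s : ℝ) (g g' g'' : Fin N × Fin N → ℝ)
    (f : Config N × Config N → ℝ) : ℝ :=
  (∑ ρ : Config N × Config N, f ρ * wTS N β t s g g' g'' ρ) /
    (∑ ρ : Config N × Config N, wTS N β t s g g' g'' ρ)

/-- The coupled cavity Gibbs average `⟨f⟩_{t,s}` of a function of two pairs. -/
def gibbsTS2 (N : ℕ) (β t s : ℝ) (g g' g'' : Fin N × Fin N → ℝ)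
    (f : Config N × Config N → Config N × Config N → ℝ) : ℝ :=
  (∑ ρ₁ : Config N × Config N, ∑ ρ₂ : Config N × Config N,
    f ρ₁ ρ₂ * wTS N β t s g g' g'' ρ₁ * wTS N β t s g g' g'' ρ₂) /
    (∑ ρ : Config N × Config N, wTS N β t s g g' g'' ρ) ^ 2

/-- The coupled cavity Gibbs average `⟨f⟩_{t,s}` of a function of `n` pairs. -/
def gibbsTSn (N : ℕ) (β t s : ℝ) (g g' g'' : Fin N × Fin N → ℝ) {n : ℕ}
    (f : (Fin n → Config N × Config N) → ℝ) : ℝ :=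
  (∑ ρ : Fin n → Config N × Config N, f ρ * ∏ l, wTS N β t s g g' g'' (ρ l)) /
    (∑ ρ₀ : Config N × Config N, wTS N β t s g g' g'' ρ₀) ^ n

/-- Disorder expectation `E⟨f⟩_{t,s}` (one pair). -/
def EgibbsTS1 (N : ℕ) (β t s : ℝ) (f : Config N × Config N → ℝ) : ℝ :=
  ∫ ω, gibbsTS1 N β t s ω.1 ω.2.1 ω.2.2 f ∂disM3 N

/-- Disorder expectation `E⟨f⟩_{t,s}` (two pairs). -/
def EgibbsTS2 (N : ℕ) (β t s : ℝ)
    (f : Config N × Config N → Config N × Config N → ℝ) : ℝ :=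
  ∫ ω, gibbsTS2 N β t s ω.1 ω.2.1 ω.2.2 f ∂disM3 N

/-- Disorder expectation `E⟨f⟩_{t,s}` (`n` pairs). -/
def EgibbsTSn (N : ℕ) (β t s : ℝ) {n : ℕ}
    (f : (Fin n → Config N × Config N) → ℝ) : ℝ :=
  ∫ ω, gibbsTSn N β t s ω.1 ω.2.1 ω.2.2 f ∂disM3 N

/-- The covariance kernel `U(ρ, ρ')` of the `s`-part of the coupled cavity Hamiltonians. -/
def Ufun (N : ℕ) (β t : ℝ) (ρ ρ' : Config N × Config N) : ℝ :=
  β ^ 2 / 2 * (spinLast ρ.1 * spinLast ρ'.1 * ovlpm N ρ.1 ρ'.1 +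
      spinLast ρ.2 * spinLast ρ'.2 * ovlpm N ρ.2 ρ'.2) +
    β ^ 2 * t / 2 * (spinLast ρ.1 * spinLast ρ'.2 * ovlpm N ρ.1 ρ'.2 +
      spinLast ρ.2 * spinLast ρ'.1 * ovlpm N ρ.2 ρ'.1)

/-- `ν(β) = −(1/2)·ln(1 − β²) − β²/2`. -/
def nuSK (b : ℝ) : ℝ := -(1 / 2) * Real.log (1 - b ^ 2) - b ^ 2 / 2

lemma spin_sq (b : Bool) : spin b * spin b = 1 := by cases b <;> simp [spin]

lemma abs_spin (b : Bool) : |spin b| = 1 := by cases b <;> simp [spin]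

lemma spin_not (b : Bool) : spin (!b) = -spin b := by cases b <;> simp [spin]

/-- A product of hyperbolic cosines is an average of exponentials over signs. -/
lemma prod_cosh_eq_sum {J : Type*} [Fintype J] [DecidableEq J] (y : J → ℝ) :
    ∏ j, cosh (y j) =
      (∑ ε : J → Bool, exp (∑ j, spin (ε j) * y j)) / 2 ^ Fintype.card J := by
  have h : ∀ j, cosh (y j) = (∑ b : Bool, exp (spin b * y j)) / 2 := by
    intro j
    rw [Real.cosh_eq]
    simp [spin]
  simp_rw [h, Finset.prod_div_distrib, Finset.prod_univ_sum, Fintype.piFinset_univ, ← exp_sum]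
  simp

/-- Distinct coordinates of a uniform sign vector are uncorrelated. -/
lemma sum_spin_mul_spin {J : Type*} [Fintype J] [DecidableEq J] {j k : J} (h : j ≠ k) :
    ∑ ε : J → Bool, spin (ε j) * spin (ε k) = 0 := by
  have hinv : Function.Involutive fun ε : J → Bool => Function.update ε j (!ε j) := by
    intro ε
    simp
  have := Equiv.sum_comp hinv.toPerm fun ε : J → Bool => spin (ε j) * spin (ε k)
  simp [Function.Involutive.toPerm, Function.update_of_ne h.symm, spin_not] at this
  linarith

lemma abs_exp_sub_one_sub_le (q : ℝ) : |exp q - 1 - q| ≤ q ^ 2 * exp |q| := by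
  have := Complex.norm_exp_sub_sum_le_norm_mul_exp (q : ℂ) 2
  simp only [Finset.sum_range_succ, Finset.sum_range_zero] at this
  simp at this
  rw [← sub_sub] at this
  rw [← Real.norm_eq_abs]
  have h2 : ‖exp q - 1 - q‖ = ‖Complex.exp q - 1 - q‖ := by
    rw [← Complex.norm_real]; push_cast; rfl
  rw [h2]; exact this

/-- The joint moment generating function of the variables `x j` is that of a centered Gaussian
vector with covariance `c`. -/
def HasGaussianMGF {Ω J : Type*} [MeasurableSpace Ω] [Fintype J] (μ : Measure Ω)
    (x : J → Ω → ℝ) (c : J → J → ℝ) : Prop :=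
  ∀ θ : J → ℝ, Integrable (fun ω => exp (∑ j, θ j * x j ω)) μ ∧
    ∫ ω, exp (∑ j, θ j * x j ω) ∂μ = exp ((∑ j, ∑ k, θ j * θ k * c j k) / 2)

section Gaussian
variable {Ω J : Type*} [MeasurableSpace Ω] [Fintype J] [DecidableEq J] {μ : Measure Ω}
  {x : J → Ω → ℝ} {c : J → J → ℝ}

lemma HasGaussianMGF.integrable_prod_cosh (h : HasGaussianMGF μ x c) (u : J → ℝ) :
    Integrable (fun ω => ∏ j, cosh (u j * x j ω)) μ := by
  simp_rw [prod_cosh_eq_sum, ← mul_assoc]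
  exact (integrable_finsetSum _ fun ε _ => (h fun j => spin (ε j) * u j).1).div_const _

lemma HasGaussianMGF.integral_prod_cosh (h : HasGaussianMGF μ x c) (u : J → ℝ) :
    ∫ ω, ∏ j, cosh (u j * x j ω) ∂μ =
      (∑ ε : J → Bool, exp ((∑ j, ∑ k, (spin (ε j) * u j) * (spin (ε k) * u k) * c j k) / 2)) /
        2 ^ Fintype.card J := by
  simp_rw [prod_cosh_eq_sum, ← mul_assoc]
  rw [integral_div, integral_finsetSum _ fun ε _ => (h fun j => spin (ε j) * u j).1]
  congr 1
  refine Finset.sum_congr rfl fun ε _ => ?_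
  rw [(h fun j => spin (ε j) * u j).2]
  simp only [mul_assoc]

lemma sum_sum_eq_diag_add_offDiag (F : J → J → ℝ) :
    ∑ j, ∑ k, F j k = ∑ j, F j j + ∑ p ∈ (univ : Finset J).offDiag, F p.1 p.2 := by
  rw [← Finset.sum_product' univ univ F, ← Finset.diag_union_offDiag,
    Finset.sum_union (Finset.disjoint_diag_offDiag _), Finset.sum_diag]

/-- If the correlations are at most one, the normalized expectation of a product of hyperbolic
cosines differs from one by at most a quadratic expression in the correlations. -/
lemma HasGaussianMGF.abs_integral_prod_cosh_sub_one_le (h : HasGaussianMGF μ x c) (u : J → ℝ)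
    (hu : ∀ j, |u j| ≤ 1) (hc : ∀ j k, |c j k| ≤ 1) :
    |exp (-(∑ j, u j ^ 2 * c j j) / 2) * ∫ ω, ∏ j, cosh (u j * x j ω) ∂μ - 1| ≤
      exp ((univ : Finset J).offDiag.card) * (univ : Finset J).offDiag.card *
        ∑ p ∈ (univ : Finset J).offDiag, c p.1 p.2 ^ 2 := by
  set P := (univ : Finset J).offDiag with hP
  set Q : (J → Bool) → ℝ := fun ε =>
    (∑ p ∈ P, (spin (ε p.1) * u p.1) * (spin (ε p.2) * u p.2) * c p.1 p.2) / 2 with hQ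
  set n : ℝ := 2 ^ Fintype.card J with hn
  have hn0 : 0 < n := by positivity
  have hcard : ∑ _ε : J → Bool, (1 : ℝ) = n := by simp [hn]
  have hsplit : exp (-(∑ j, u j ^ 2 * c j j) / 2) * ∫ ω, ∏ j, cosh (u j * x j ω) ∂μ =
      (∑ ε, exp (Q ε)) / n := by
    rw [h.integral_prod_cosh, ← mul_div_assoc, Finset.mul_sum]
    congr 1
    refine Finset.sum_congr rfl fun ε _ => ?_
    rw [← exp_add]
    congr 1
    have hd : ∑ j, spin (ε j) * u j * (spin (ε j) * u j) * c j j = ∑ j, u j ^ 2 * c j j :=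
      Finset.sum_congr rfl fun j _ => by linear_combination (u j ^ 2 * c j j) * spin_sq (ε j)
    rw [sum_sum_eq_diag_add_offDiag, hd]
    simp only [hQ]
    ring
  have hterm : ∀ (ε : J → Bool) (p : J × J),
      |spin (ε p.1) * u p.1 * (spin (ε p.2) * u p.2) * c p.1 p.2| ≤ |c p.1 p.2| := by
    intro ε p
    simp only [abs_mul, abs_spin, one_mul]
    have : |u p.1| * |u p.2| ≤ 1 := mul_le_one₀ (hu _) (abs_nonneg _) (hu _)
    nlinarith [abs_nonneg (c p.1 p.2)]
  have hQabs : ∀ ε, |Q ε| ≤ P.card := by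
    intro ε
    have h1 : |∑ p ∈ P, (spin (ε p.1) * u p.1) * (spin (ε p.2) * u p.2) * c p.1 p.2| ≤ P.card := by
      refine (Finset.abs_sum_le_sum_abs _ _).trans ?_
      refine (Finset.sum_le_card_nsmul _ _ 1 fun p _ => (hterm ε p).trans (hc _ _)).trans ?_
      simp
    simp only [hQ, abs_div, abs_two]
    linarith [abs_nonneg (∑ p ∈ P, (spin (ε p.1) * u p.1) * (spin (ε p.2) * u p.2) * c p.1 p.2)]
  have hQsq : ∀ ε, Q ε ^ 2 ≤ P.card * ∑ p ∈ P, c p.1 p.2 ^ 2 := by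
    intro ε
    have h1 := sq_sum_le_card_mul_sum_sq (s := P)
      (f := fun p => (spin (ε p.1) * u p.1) * (spin (ε p.2) * u p.2) * c p.1 p.2)
    have h2 : ∑ p ∈ P, ((spin (ε p.1) * u p.1) * (spin (ε p.2) * u p.2) * c p.1 p.2) ^ 2 ≤
        ∑ p ∈ P, c p.1 p.2 ^ 2 := Finset.sum_le_sum fun p _ => sq_le_sq.2 (hterm ε p)
    have h3 := mul_le_mul_of_nonneg_left h2 (Nat.cast_nonneg (α := ℝ) P.card)
    simp only [hQ, div_pow]
    nlinarith [sq_nonneg (∑ p ∈ P, (spin (ε p.1) * u p.1) * (spin (ε p.2) * u p.2) * c p.1 p.2)]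
  have hQmean : ∑ ε, Q ε = 0 := by
    simp only [hQ]
    rw [← Finset.sum_div, Finset.sum_comm, Finset.sum_eq_zero, zero_div]
    intro p hp
    have := sum_spin_mul_spin (Finset.mem_offDiag.1 hp).2.2
    calc _ = (∑ ε : J → Bool, spin (ε p.1) * spin (ε p.2)) * (u p.1 * u p.2 * c p.1 p.2) := by
          rw [Finset.sum_mul]; exact Finset.sum_congr rfl fun _ _ => by ring
      _ = 0 := by rw [this, zero_mul]
  have hsum : (∑ ε, exp (Q ε)) / n - 1 = (∑ ε, (exp (Q ε) - 1 - Q ε)) / n := by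
    rw [Finset.sum_sub_distrib, Finset.sum_sub_distrib, hQmean, hcard]
    field_simp
    ring
  rw [hsplit, hsum, abs_div, abs_of_pos hn0, div_le_iff₀ hn0, ← hcard, Finset.mul_sum]
  refine (Finset.abs_sum_le_sum_abs _ _).trans (Finset.sum_le_sum fun ε _ => ?_)
  refine (abs_exp_sub_one_sub_le _).trans ?_
  rw [mul_one, mul_assoc, mul_comm (Q ε ^ 2)]
  exact mul_le_mul (exp_le_exp.2 (hQabs ε)) (hQsq ε) (sq_nonneg _) (exp_pos _).le

end Gaussian

section Tilting
variable {Ω S : Type*} [MeasurableSpace Ω] [Fintype S] {μ : Measure Ω} [IsProbabilityMeasure μ]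
  {p f : S → ℝ} {A : S → Ω → ℝ}

lemma one_le_sum_mul (hp : ∀ a, 0 ≤ p a) (hp1 : ∑ a, p a = 1) {v : S → ℝ} (hv : ∀ a, 1 ≤ v a) :
    1 ≤ ∑ a, p a * v a := by
  rw [← hp1]
  exact Finset.sum_le_sum fun a _ => le_mul_of_one_le_right (hp a) (hv a)

/-- Tilted averages of a fixed function are integrable in the random tilt. -/
lemma integrable_tilted (hp : ∀ a, 0 ≤ p a) (hp1 : ∑ a, p a = 1) (hA : ∀ a ω, 1 ≤ A a ω)
    (hm : ∀ a, AEStronglyMeasurable (A a) μ) (f : S → ℝ) :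
    Integrable (fun ω => (∑ a, p a * f a * A a ω) / ∑ a, p a * A a ω) μ := by
  refine Integrable.of_bound (C := ∑ a, |f a|) ?_ (Eventually.of_forall fun ω => ?_)
  · have h1 : ∀ v : S → ℝ, AEMeasurable (fun ω => ∑ a, v a * A a ω) μ := fun v =>
      Finset.aemeasurable_fun_sum _ fun a _ => ((hm a).aemeasurable.const_mul _)
    exact ((h1 _).div (h1 _)).aestronglyMeasurable
  · have hB : 0 < ∑ a, p a * A a ω := one_pos.trans_le (one_le_sum_mul hp hp1 (hA · ω))
    rw [Real.norm_eq_abs, abs_div, abs_of_pos hB, div_le_iff₀ hB]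
    refine (Finset.abs_sum_le_sum_abs _ _).trans ?_
    rw [Finset.mul_sum]
    refine Finset.sum_le_sum fun a _ => ?_
    have hpA : 0 ≤ p a * A a ω := mul_nonneg (hp a) (zero_le_one.trans (hA a ω))
    have : |p a * f a * A a ω| = |f a| * (p a * A a ω) := by
      rw [← abs_of_nonneg hpA, ← abs_mul]; congr 1; ring
    rw [this]
    exact mul_le_mul_of_nonneg_right
      (Finset.single_le_sum (f := fun a => |f a|) (fun _ _ => abs_nonneg _) (mem_univ a)) hpA

/-- A random tilt by a factor `A ≥ 1` with bounded mean decreases averages of nonnegative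
functions by at most a constant factor. -/
lemma sum_le_mul_integral_tilted (hp : ∀ a, 0 ≤ p a) (hp1 : ∑ a, p a = 1) (hf : ∀ a, 0 ≤ f a)
    (hA : ∀ a ω, 1 ≤ A a ω) (hint : ∀ a, Integrable (A a) μ) {M : ℝ} (hM : 0 < M)
    (hmean : ∀ a, ∫ ω, A a ω ∂μ ≤ M) :
    ∑ a, p a * f a ≤ M * ∫ ω, (∑ a, p a * f a * A a ω) / (∑ a, p a * A a ω) ∂μ := by
  set F := ∑ a, p a * f a with hF
  have hF0 : 0 ≤ F := Finset.sum_nonneg fun a _ => mul_nonneg (hp a) (hf a)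
  have hBint : Integrable (fun ω => ∑ a, p a * A a ω) μ :=
    integrable_finsetSum _ fun a _ => (hint a).const_mul _
  have hBmean : ∫ ω, ∑ a, p a * A a ω ∂μ ≤ M := by
    rw [integral_finsetSum _ fun a _ => (hint a).const_mul _]
    simp_rw [integral_const_mul]
    calc ∑ a, p a * ∫ ω, A a ω ∂μ ≤ ∑ a, p a * M :=
          Finset.sum_le_sum fun a _ => mul_le_mul_of_nonneg_left (hmean a) (hp a)
      _ = M := by rw [← Finset.sum_mul, hp1, one_mul]
  have hlow : ∀ ω, F * (2 / M - (∑ a, p a * A a ω) / M ^ 2) ≤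
      (∑ a, p a * f a * A a ω) / (∑ a, p a * A a ω) := by
    intro ω
    have hB : 0 < ∑ a, p a * A a ω := one_pos.trans_le (one_le_sum_mul hp hp1 (hA · ω))
    have hX : F ≤ ∑ a, p a * f a * A a ω := Finset.sum_le_sum fun a _ =>
      le_mul_of_one_le_right (mul_nonneg (hp a) (hf a)) (hA a ω)
    set B := ∑ a, p a * A a ω
    have h1 : 2 / M - B / M ^ 2 ≤ 1 / B := by
      rw [← sub_nonneg]
      have : 1 / B - (2 / M - B / M ^ 2) = (B - M) ^ 2 / (B * M ^ 2) := by
        field_simp; ring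
      rw [this]; positivity
    calc F * (2 / M - B / M ^ 2) ≤ F * (1 / B) := mul_le_mul_of_nonneg_left h1 hF0
      _ = F / B := by ring
      _ ≤ _ := div_le_div_of_nonneg_right hX hB.le
  have hmono := integral_mono (((integrable_const (2 / M)).sub (hBint.div_const (M ^ 2))).const_mul F)
    (integrable_tilted hp hp1 hA (fun a => (hint a).aestronglyMeasurable) f) hlow
  have hval : ∫ ω, F * (2 / M - (∑ a, p a * A a ω) / M ^ 2) ∂μ =
      F * (2 / M - (∫ ω, ∑ a, p a * A a ω ∂μ) / M ^ 2) := by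
    rw [integral_const_mul, integral_sub (integrable_const _) (hBint.div_const _)]
    simp only [integral_div, integral_const, probReal_univ, one_smul]
  have h2 : F / M ≤ F * (2 / M - (∫ ω, ∑ a, p a * A a ω ∂μ) / M ^ 2) := by
    have h3 : (∫ ω, ∑ a, p a * A a ω ∂μ) / M ^ 2 ≤ M / M ^ 2 := by gcongr
    have h4 : M / M ^ 2 = 1 / M := by field_simp
    have h5 : 2 / M - 1 / M = 1 / M := by ring
    calc F / M = F * (1 / M) := by ring
      _ ≤ _ := mul_le_mul_of_nonneg_left (by linarith) hF0
  have h6 : F / M ≤ ∫ ω, (∑ a, p a * f a * A a ω) / (∑ a, p a * A a ω) ∂μ :=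
    h2.trans (hval ▸ hmono)
  rwa [div_le_iff₀' hM] at h6

/-- Second-order expansion of a tilted average: if the normalized moments of order one, two and
three of the random tilt `A` are within `D` of one, then the expected tilted average of `f` is
close to its untilted average. -/
lemma abs_integral_tilted_sub_le (hp : ∀ a, 0 ≤ p a) (hp1 : ∑ a, p a = 1) (hf : ∀ a, 0 ≤ f a)
    (hA : ∀ a ω, 1 ≤ A a ω) {m : ℝ} (hm : 0 < m) {D : S → S → S → ℝ}
    (hint1 : ∀ a, Integrable (A a) μ)
    (hint2 : ∀ a b, Integrable (fun ω => A a ω * A b ω) μ)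
    (hint3 : ∀ a b c, Integrable (fun ω => A a ω * A b ω * A c ω) μ)
    (h1 : ∀ a b c, |(∫ ω, A a ω ∂μ) / m - 1| ≤ D a b c)
    (h2 : ∀ a b c, |(∫ ω, A a ω * A b ω ∂μ) / m ^ 2 - 1| ≤ D a b c)
    (h2' : ∀ a b c, |(∫ ω, A a ω * A c ω ∂μ) / m ^ 2 - 1| ≤ D a b c)
    (h3 : ∀ a b c, |(∫ ω, A a ω * A b ω * A c ω ∂μ) / m ^ 3 - 1| ≤ D a b c) :
    |∫ ω, (∑ a, p a * f a * A a ω) / (∑ a, p a * A a ω) ∂μ - ∑ a, p a * f a| ≤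
      (3 + 4 * m) * ∑ a, ∑ b, ∑ c, p a * p b * p c * (f a * D a b c) := by
  set T := ∑ a, ∑ b, ∑ c, p a * p b * p c * (f a * D a b c) with hT
  -- weighted triple averages
  set W : (S → S → S → ℝ) → ℝ := fun G => ∑ a, ∑ b, ∑ c, p a * p b * p c * (f a * G a b c) with hW
  have hWle : ∀ (G : S → S → S → ℝ) (k : ℝ), (∀ a b c, |G a b c| ≤ k * D a b c) → |W G| ≤ k * T := by
    intro G k hG
    simp only [hW, hT, Finset.mul_sum]
    refine (Finset.abs_sum_le_sum_abs _ _).trans (Finset.sum_le_sum fun a _ => ?_)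
    refine (Finset.abs_sum_le_sum_abs _ _).trans (Finset.sum_le_sum fun b _ => ?_)
    refine (Finset.abs_sum_le_sum_abs _ _).trans (Finset.sum_le_sum fun c _ => ?_)
    rw [abs_mul, abs_mul (f a), abs_of_nonneg (hf a),
      abs_of_nonneg (mul_nonneg (mul_nonneg (hp a) (hp b)) (hp c))]
    have := mul_le_mul_of_nonneg_left (hG a b c) (mul_nonneg
      (mul_nonneg (mul_nonneg (hp a) (hp b)) (hp c)) (hf a))
    linarith
  have hWint : ∀ G : S → S → S → Ω → ℝ, (∀ a b c, Integrable (G a b c) μ) →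
      Integrable (fun ω => W fun a b c => G a b c ω) μ ∧
      ∫ ω, W (fun a b c => G a b c ω) ∂μ = W fun a b c => ∫ ω, G a b c ω ∂μ := by
    intro G hG
    have i3 : ∀ a b c, Integrable (fun ω => p a * p b * p c * (f a * G a b c ω)) μ :=
      fun a b c => ((hG a b c).const_mul _).const_mul _
    have i2 := fun a b => integrable_finsetSum univ fun c _ => i3 a b c
    have i1 := fun a => integrable_finsetSum univ fun b _ => i2 a b
    refine ⟨integrable_finsetSum univ fun a _ => i1 a, ?_⟩
    simp only [hW]
    rw [integral_finsetSum _ fun a _ => i1 a]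
    refine Finset.sum_congr rfl fun a _ => ?_
    rw [integral_finsetSum _ fun b _ => i2 a b]
    refine Finset.sum_congr rfl fun b _ => ?_
    rw [integral_finsetSum _ fun c _ => i3 a b c]
    refine Finset.sum_congr rfl fun c _ => ?_
    rw [integral_const_mul, integral_const_mul]
  have hWfac : ∀ (x y z : S → ℝ), (W fun a b c => x a * y b * z c) =
      (∑ a, p a * f a * x a) * (∑ b, p b * y b) * ∑ c, p c * z c := by
    intro x y z
    simp only [hW]
    rw [Finset.sum_mul_sum, Finset.sum_mul]
    refine Finset.sum_congr rfl fun a _ => ?_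
    rw [Finset.sum_mul_sum]
    exact Finset.sum_congr rfl fun b _ => Finset.sum_congr rfl fun c _ => by ring
  set G1 : S → S → S → Ω → ℝ := fun a _ _ ω => A a ω / m - 1 with hG1
  set G2 : S → S → S → Ω → ℝ := fun a b _ ω => A a ω * A b ω / m ^ 2 - A a ω / m with hG2
  set G3 : S → S → S → Ω → ℝ := fun a b c ω => A a ω * A b ω * A c ω / m ^ 3 -
    A a ω * A b ω / m ^ 2 - A a ω * A c ω / m ^ 2 + A a ω / m with hG3
  have j1 := fun a => (hint1 a).div_const m
  have j2 := fun a b => (hint2 a b).div_const (m ^ 2)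
  have j3 := fun a b c => (hint3 a b c).div_const (m ^ 3)
  have k1 : ∀ a b c, Integrable (G1 a b c) μ := fun a b c => (j1 a).sub (integrable_const 1)
  have k2 : ∀ a b c, Integrable (G2 a b c) μ := fun a b c => (j2 a b).sub (j1 a)
  have k3 : ∀ a b c, Integrable (G3 a b c) μ := fun a b c =>
    (((j3 a b c).sub (j2 a b)).sub (j2 a c)).add (j1 a)
  have e1 : ∀ a b c, |∫ ω, G1 a b c ω ∂μ| ≤ 1 * D a b c := by
    intro a b c
    simp only [hG1]
    rw [integral_sub (j1 a) (integrable_const 1), integral_div]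
    simpa using h1 a b c
  have e2 : ∀ a b c, |∫ ω, G2 a b c ω ∂μ| ≤ 2 * D a b c := by
    intro a b c
    simp only [hG2]
    rw [integral_sub (j2 a b) (j1 a), integral_div, integral_div]
    have := h1 a b c
    have := h2 a b c
    rw [abs_le] at *
    constructor <;> linarith
  have e3 : ∀ a b c, |∫ ω, G3 a b c ω ∂μ| ≤ 4 * D a b c := by
    intro a b c
    simp only [hG3]
    rw [integral_add (((j3 a b c).sub' (j2 a b)).sub' (j2 a c)) (j1 a),
      integral_sub ((j3 a b c).sub' (j2 a b)) (j2 a c), integral_sub (j3 a b c) (j2 a b),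
      integral_div, integral_div, integral_div, integral_div]
    have := h1 a b c
    have := h2 a b c
    have := h2' a b c
    have := h3 a b c
    rw [abs_le] at *
    constructor <;> linarith
  -- pointwise expansion
  have hpt : ∀ ω, |(∑ a, p a * f a * A a ω) / (∑ a, p a * A a ω) - ∑ a, p a * f a -
      ((W fun a b c => G1 a b c ω) - W fun a b c => G2 a b c ω)| ≤
      m * W fun a b c => G3 a b c ω := by
    intro ω
    have hB1 : 1 ≤ ∑ a, p a * A a ω := one_le_sum_mul hp hp1 (hA · ω)
    have w1 : (W fun a b c => G1 a b c ω) = (∑ a, p a * f a * A a ω) / m - ∑ a, p a * f a := by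
      have := hWfac (fun a => G1 a a a ω) (fun _ => 1) (fun _ => 1)
      simp only [mul_one, hp1] at this
      refine this.trans ?_
      rw [Finset.sum_div, ← Finset.sum_sub_distrib]
      exact Finset.sum_congr rfl fun a _ => by simp only [hG1]; ring
    have hm1 : ∑ b, p b * (A b ω / m - 1) = (∑ b, p b * A b ω) / m - 1 := by
      rw [Finset.sum_div, ← hp1, ← Finset.sum_sub_distrib]
      exact Finset.sum_congr rfl fun a _ => by rw [hp1]; ring
    have hm2 : ∑ a, p a * f a * (A a ω / m) = (∑ a, p a * f a * A a ω) / m := by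
      rw [Finset.sum_div]
      exact Finset.sum_congr rfl fun a _ => by ring
    have w2 : (W fun a b c => G2 a b c ω) =
        (∑ a, p a * f a * A a ω) / m * ((∑ b, p b * A b ω) / m - 1) := by
      have := hWfac (fun a => A a ω / m) (fun b => A b ω / m - 1) (fun _ => 1)
      simp only [mul_one, hp1] at this
      rw [hm1, hm2] at this
      rw [← this]
      congr 1
      funext a b c
      simp only [hG2]
      field_simp
    have w3 : (W fun a b c => G3 a b c ω) =
        (∑ a, p a * f a * A a ω) / m * ((∑ b, p b * A b ω) / m - 1) ^ 2 := by
      have := hWfac (fun a => A a ω / m) (fun b => A b ω / m - 1) (fun b => A b ω / m - 1)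
      rw [hm1, hm2] at this
      rw [pow_two, ← mul_assoc, ← this]
      congr 1
      funext a b c
      simp only [hG3]
      field_simp
      ring
    have hX : 0 ≤ ∑ a, p a * f a * A a ω := Finset.sum_nonneg fun a _ =>
      mul_nonneg (mul_nonneg (hp a) (hf a)) (zero_le_one.trans (hA a ω))
    rw [w1, w2, w3]
    set B := ∑ a, p a * A a ω
    set X := ∑ a, p a * f a * A a ω
    have hB : 0 < B := by linarith
    have key : X / B - ∑ a, p a * f a - (X / m - ∑ a, p a * f a - X / m * (B / m - 1)) =
        (m * (X / m * (B / m - 1) ^ 2)) / B := by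
      field_simp
      ring
    have hnn : 0 ≤ m * (X / m * (B / m - 1) ^ 2) := by positivity
    rw [key, abs_of_nonneg (div_nonneg hnn hB.le)]
    exact div_le_self hnn hB1
  obtain ⟨l1, v1⟩ := hWint G1 k1
  obtain ⟨l2, v2⟩ := hWint G2 k2
  obtain ⟨l3, v3⟩ := hWint G3 k3
  have hti := integrable_tilted hp hp1 hA (fun a => (hint1 a).aestronglyMeasurable) f
  have hmain : |∫ ω, ((∑ a, p a * f a * A a ω) / (∑ a, p a * A a ω) - ∑ a, p a * f a -
      ((W fun a b c => G1 a b c ω) - W fun a b c => G2 a b c ω)) ∂μ| ≤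
      m * W fun a b c => ∫ ω, G3 a b c ω ∂μ := by
    refine abs_integral_le_integral_abs.trans ?_
    rw [← v3, ← integral_const_mul]
    exact integral_mono (((hti.sub (integrable_const _)).sub (l1.sub l2)).abs) (l3.const_mul m) hpt
  rw [integral_sub (hti.sub' (integrable_const _)) (l1.sub' l2), integral_sub hti (integrable_const _),
    integral_sub l1 l2, v1, v2] at hmain
  simp only [integral_const, probReal_univ, one_smul] at hmain
  have b1 := hWle _ _ e1
  have b2 := hWle _ _ e2
  have b3 := mul_le_mul_of_nonneg_left ((le_abs_self _).trans (hWle _ _ e3)) hm.le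
  rw [abs_le] at *
  constructor <;> linarith

end Tilting

section MeasurePreservation

lemma integral_eq_of_measurePreserving {X Y : Type*} [MeasurableSpace X] [MeasurableSpace Y]
    {μ : Measure X} {ν : Measure Y} {φ : X → Y} (hφ : MeasurePreserving φ μ ν) {F : Y → ℝ}
    (hF : Measurable F) : ∫ y, F y ∂ν = ∫ x, F (φ x) ∂μ := by
  rw [← hφ.map_eq, integral_map hφ.measurable.aemeasurable hF.aestronglyMeasurable]

/-- Coordinatewise measure preserving maps of two independent product measures. -/
lemma measurePreserving_pi_prod {ι : Type*} [Fintype ι] {γ : Measure ℝ} [SigmaFinite γ]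
    {φ : ι → ℝ × ℝ → ℝ} (hφ : ∀ i, MeasurePreserving (φ i) (γ.prod γ) γ) :
    MeasurePreserving (fun (z : (ι → ℝ) × (ι → ℝ)) i => φ i (z.1 i, z.2 i))
      ((Measure.pi fun _ => γ).prod (Measure.pi fun _ => γ)) (Measure.pi fun _ => γ) :=
  (measurePreserving_pi (fun _ => γ.prod γ) (fun _ => γ) hφ).comp
    (measurePreserving_arrowProdEquivProdArrow ℝ ℝ ι (fun _ => γ) (fun _ => γ)).symm

lemma measurePreserving_prodProdProdComm {X Y X' Y' : Type*} [MeasurableSpace X]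
    [MeasurableSpace Y] [MeasurableSpace X'] [MeasurableSpace Y'] (μ : Measure X) (ν : Measure Y)
    (μ' : Measure X') (ν' : Measure Y') [SFinite μ] [SFinite ν] [SFinite μ'] [SFinite ν'] :
    MeasurePreserving (fun z : (X × Y) × (X' × Y') => ((z.1.1, z.2.1), (z.1.2, z.2.2)))
      ((μ.prod ν).prod (μ'.prod ν')) ((μ.prod μ').prod (ν.prod ν')) := by
  have hinner : MeasurePreserving (fun z : Y × (X' × Y') => (z.2.1, (z.1, z.2.2)))
      (ν.prod (μ'.prod ν')) (μ'.prod (ν.prod ν')) :=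
    (measurePreserving_prodAssoc μ' ν ν').comp
      ((Measure.measurePreserving_swap.prod (MeasurePreserving.id ν')).comp
        (MeasurePreserving.symm _ (measurePreserving_prodAssoc ν μ' ν')))
  exact (MeasurePreserving.symm _ (measurePreserving_prodAssoc μ μ' (ν.prod ν'))).comp
    (((MeasurePreserving.id μ).prod hinner).comp
      (measurePreserving_prodAssoc μ ν (μ'.prod ν')))

/-- Binary measure preserving operations can be combined on a product space. -/
lemma measurePreserving_prod_binary {X Y : Type*} [MeasurableSpace X] [MeasurableSpace Y]
    {μ : Measure X} {ν : Measure Y} [SFinite μ] [SFinite ν] {φ : X × X → X} {ψ : Y × Y → Y}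
    (hφ : MeasurePreserving φ (μ.prod μ) μ) (hψ : MeasurePreserving ψ (ν.prod ν) ν) :
    MeasurePreserving (fun z : (X × Y) × (X × Y) => (φ (z.1.1, z.2.1), ψ (z.1.2, z.2.2)))
      ((μ.prod ν).prod (μ.prod ν)) (μ.prod ν) :=
  (hφ.prod hψ).comp (measurePreserving_prodProdProdComm μ ν μ ν)

end MeasurePreservation

section Disorder

/-- Keep the couplings among the first `N - 1` sites and replace all others. -/
def resample {N : ℕ} (z : (Fin N × Fin N → ℝ) × (Fin N × Fin N → ℝ)) (p : Fin N × Fin N) : ℝ :=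
  if (p.2 : ℕ) < N - 1 then z.1 p else z.2 p

/-- Resampling in each of the three independent copies of the disorder. -/
def resampleTriple {N : ℕ}
    (z : ((Fin N × Fin N → ℝ) × (Fin N × Fin N → ℝ) × (Fin N × Fin N → ℝ)) ×
      ((Fin N × Fin N → ℝ) × (Fin N × Fin N → ℝ) × (Fin N × Fin N → ℝ))) :
    (Fin N × Fin N → ℝ) × (Fin N × Fin N → ℝ) × (Fin N × Fin N → ℝ) :=
  (resample (z.1.1, z.2.1), resample (z.1.2.1, z.2.2.1), resample (z.1.2.2, z.2.2.2))

lemma measurePreserving_resample (N : ℕ) :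
    MeasurePreserving (resample (N := N)) ((gaussPi N).prod (gaussPi N)) (gaussPi N) := by
  refine measurePreserving_pi_prod (γ := gaussianReal 0 1)
    (φ := fun (p : Fin N × Fin N) z => if (p.2 : ℕ) < N - 1 then z.1 else z.2) fun p => ?_
  by_cases h : (p.2 : ℕ) < N - 1
  · simpa [h] using measurePreserving_fst
  · simpa [h] using measurePreserving_snd

instance (N : ℕ) : IsProbabilityMeasure (disM3 N) := by
  unfold disM3; infer_instance

lemma measurePreserving_resampleTriple (N : ℕ) :
    MeasurePreserving (resampleTriple (N := N)) ((disM3 N).prod (disM3 N)) (disM3 N) :=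
  measurePreserving_prod_binary (measurePreserving_resample N)
    (measurePreserving_prod_binary (measurePreserving_resample N) (measurePreserving_resample N))

/-- The interpolation `√t g + √(1-t) g'` of two independent copies has the law of one copy. -/
lemma measurePreserving_interpolation (N : ℕ) {t : ℝ} (ht : t ∈ Set.Icc (0 : ℝ) 1) :
    MeasurePreserving (fun (z : (Fin N × Fin N → ℝ) × (Fin N × Fin N → ℝ)) p =>
      √t * z.1 p + √(1 - t) * z.2 p) ((gaussPi N).prod (gaussPi N)) (gaussPi N) := by
  refine measurePreserving_pi_prod (γ := gaussianReal 0 1)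
    (φ := fun _ z => √t * z.1 + √(1 - t) * z.2) fun _ => ⟨by fun_prop, ?_⟩
  have hX : ∀ a : ℝ, MeasurePreserving (a * ·) (gaussianReal 0 1)
      (gaussianReal 0 (.mk (a ^ 2) (sq_nonneg _))) := fun a =>
    ⟨by fun_prop, by rw [gaussianReal_map_const_mul]; simp⟩
  have := ((hX (√t)).prod (hX (√(1 - t)))).map_eq
  have hconv := gaussianReal_conv_gaussianReal (m₁ := 0) (m₂ := 0)
    (v₁ := .mk (√t ^ 2) (sq_nonneg _)) (v₂ := .mk (√(1 - t) ^ 2) (sq_nonneg _))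
  rw [Measure.conv, ← this, Measure.map_map (by fun_prop) (by fun_prop)] at hconv
  refine hconv.trans ?_
  congr 1
  · simp
  · ext
    simp [Real.sq_sqrt ht.1, Real.sq_sqrt (sub_nonneg.2 ht.2)]

lemma integrable_exp_linear (N : ℕ) (v : Fin N × Fin N → ℝ) :
    Integrable (fun g => exp (∑ p, v p * g p)) (gaussPi N) := by
  simp_rw [exp_sum]
  exact Integrable.fintype_prod fun p => integrable_exp_mul_gaussianReal (v p)

lemma integral_exp_linear (N : ℕ) (v : Fin N × Fin N → ℝ) :
    ∫ g, exp (∑ p, v p * g p) ∂gaussPi N = exp ((∑ p, v p ^ 2) / 2) := by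
  simp_rw [exp_sum]
  rw [gaussPi, integral_fintype_prod_eq_prod (fun p x => exp (v p * x)), Finset.sum_div, exp_sum]
  refine Finset.prod_congr rfl fun p _ => ?_
  have := mgf_gaussianReal (p := gaussianReal 0 1) (X := id) (μ := 0) (v := 1) (by simp) (v p)
  simpa [mgf] using this

/-- Moment generating function of a linear functional of the three copies of the disorder. -/
lemma exp_linear_disM3 (N : ℕ) (v₁ v₂ v₃ : Fin N × Fin N → ℝ) :
    Integrable (fun ω => exp (∑ p, v₁ p * ω.1 p + ∑ p, v₂ p * ω.2.1 p + ∑ p, v₃ p * ω.2.2 p))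
        (disM3 N) ∧
      ∫ ω, exp (∑ p, v₁ p * ω.1 p + ∑ p, v₂ p * ω.2.1 p + ∑ p, v₃ p * ω.2.2 p) ∂disM3 N =
        exp ((∑ p, v₁ p ^ 2 + ∑ p, v₂ p ^ 2 + ∑ p, v₃ p ^ 2) / 2) := by
  simp_rw [add_assoc, exp_add]
  refine ⟨(integrable_exp_linear N v₁).mul_prod
    ((integrable_exp_linear N v₂).mul_prod (integrable_exp_linear N v₃)), ?_⟩
  rw [disM3, integral_prod_mul (fun g : Fin N × Fin N → ℝ => exp (∑ p, v₁ p * g p))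
    (fun z : (Fin N × Fin N → ℝ) × (Fin N × Fin N → ℝ) =>
      exp (∑ p, v₂ p * z.1 p) * exp (∑ p, v₃ p * z.2 p)),
    integral_prod_mul (fun g : Fin N × Fin N → ℝ => exp (∑ p, v₂ p * g p))
      (fun g : Fin N × Fin N → ℝ => exp (∑ p, v₃ p * g p)),
    integral_exp_linear, integral_exp_linear, integral_exp_linear, ← exp_add, ← exp_add]
  congr 1
  ring

end Disorder

section CavityField

/-- The last site. -/
def lastSite {N : ℕ} (hN : 0 < N) : Fin N := ⟨N - 1, Nat.sub_lt hN Nat.one_pos⟩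

/-- The sites other than the last one. -/
def bulk (N : ℕ) : Finset (Fin N) := univ.filter fun i : Fin N => (i : ℕ) < N - 1

lemma lastSite_notMem_bulk {N : ℕ} (hN : 0 < N) : lastSite hN ∉ bulk N := by
  simp [lastSite, bulk]

lemma cavField_eq {N : ℕ} (hN : 0 < N) (β t : ℝ) (g g' : Fin N × Fin N → ℝ) (σ : Config N) :
    cavField N β t g g' σ = (β / √N) * spin (σ (lastSite hN)) *
      ∑ i ∈ bulk N, (√t * g (i, lastSite hN) + √(1 - t) * g' (i, lastSite hN)) * spin (σ i) := by
  simp [cavField, hN, lastSite, bulk]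

/-- The coupling matrix supported on the column of the last site, with entries `a`. -/
def lastColumn {N : ℕ} (hN : 0 < N) (a : Fin N → ℝ) (p : Fin N × Fin N) : ℝ :=
  if p.1 ∈ bulk N ∧ p.2 = lastSite hN then a p.1 else 0

lemma sum_lastColumn_mul {N : ℕ} (hN : 0 < N) (a : Fin N → ℝ) (G : Fin N × Fin N → ℝ) :
    ∑ p, lastColumn hN a p * G p = ∑ i ∈ bulk N, a i * G (i, lastSite hN) := by
  rw [Fintype.sum_prod_type, ← Finset.sum_filter_add_sum_filter_not univ (· ∈ bulk N),
    Finset.filter_mem_eq_inter, Finset.univ_inter]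
  have h0 : ∑ i with i ∉ bulk N, ∑ k, lastColumn hN a (i, k) * G (i, k) = 0 :=
    Finset.sum_eq_zero fun i hi => Finset.sum_eq_zero fun k _ => by
      simp [lastColumn, (Finset.mem_filter.1 hi).2]
  rw [h0, add_zero]
  refine Finset.sum_congr rfl fun i hi => ?_
  simp [lastColumn, hi]

lemma sum_lastColumn_sq {N : ℕ} (hN : 0 < N) (a : Fin N → ℝ) :
    ∑ p, lastColumn hN a p ^ 2 = ∑ i ∈ bulk N, a i ^ 2 := by
  simp_rw [pow_two]
  rw [sum_lastColumn_mul]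
  refine Finset.sum_congr rfl fun i hi => ?_
  simp [lastColumn, hi]

/-- The covariance of the cavity fields acting on the configurations `η j`, where `s j` tells which
of the two coupled systems `η j` belongs to. -/
def cavCov {N : ℕ} (hN : 0 < N) (β t : ℝ) {J : Type*} (η : J → Config N) (s : J → Bool)
    (j k : J) : ℝ :=
  β ^ 2 * (spin (η j (lastSite hN)) * spin (η k (lastSite hN))) * ovlpm N (η j) (η k) *
    if s j = s k then 1 else t

lemma hasGaussianMGF_cavField {N : ℕ} (hN : 0 < N) (β : ℝ) {t : ℝ} (ht : t ∈ Set.Icc (0 : ℝ) 1)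
    {J : Type*} [Fintype J] (η : J → Config N) (s : J → Bool) :
    HasGaussianMGF (disM3 N)
      (fun j ω => cavField N β t ω.1 (if s j then ω.2.1 else ω.2.2) (η j))
      (cavCov hN β t η s) := by
  intro θ
  set k := β / √N with hk
  set L := lastSite hN
  set ζ : J → Fin N → ℝ := fun j i => spin (η j L) * spin (η j i) with hζ
  set a₁ : Fin N → ℝ := fun i => ∑ j, k * √t * θ j * ζ j i with ha₁
  set a₂ : Fin N → ℝ := fun i => ∑ j, k * √(1 - t) * θ j * ζ j i * (if s j then 1 else 0) with ha₂
  set a₃ : Fin N → ℝ := fun i => ∑ j, k * √(1 - t) * θ j * ζ j i * (if s j then 0 else 1) with ha₃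
  have hlin : ∀ ω : (Fin N × Fin N → ℝ) × (Fin N × Fin N → ℝ) × (Fin N × Fin N → ℝ),
      ∑ j, θ j * cavField N β t ω.1 (if s j then ω.2.1 else ω.2.2) (η j) =
      ∑ p, lastColumn hN a₁ p * ω.1 p + ∑ p, lastColumn hN a₂ p * ω.2.1 p +
        ∑ p, lastColumn hN a₃ p * ω.2.2 p := by
    intro ω
    simp only [sum_lastColumn_mul, cavField_eq hN, ha₁, ha₂, ha₃, Finset.mul_sum, Finset.sum_mul]
    rw [Finset.sum_comm, ← Finset.sum_add_distrib, ← Finset.sum_add_distrib]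
    refine Finset.sum_congr rfl fun i _ => ?_
    rw [← Finset.sum_add_distrib, ← Finset.sum_add_distrib]
    refine Finset.sum_congr rfl fun j _ => ?_
    cases s j <;> simp [hζ] <;> ring
  have hN' : (0 : ℝ) < N := Nat.cast_pos.2 hN
  have hvar : ∑ p, lastColumn hN a₁ p ^ 2 + ∑ p, lastColumn hN a₂ p ^ 2 +
      ∑ p, lastColumn hN a₃ p ^ 2 = ∑ j, ∑ l, θ j * θ l * cavCov hN β t η s j l := by
    have hk2 : k ^ 2 = β ^ 2 / N := by rw [hk, div_pow, Real.sq_sqrt hN'.le]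
    have hR : ∀ j l, θ j * θ l * cavCov hN β t η s j l = ∑ i ∈ bulk N,
        k ^ 2 * (θ j * θ l * (ζ j i * ζ l i)) * (if s j = s l then 1 else t) := by
      intro j l
      rw [hk2]
      simp only [cavCov, ovlpm, Finset.sum_div, Finset.mul_sum, Finset.sum_mul, hζ]
      refine Finset.sum_congr rfl fun i _ => ?_
      ring
    simp only [sum_lastColumn_sq, hR]
    rw [← Finset.sum_add_distrib, ← Finset.sum_add_distrib]
    have hswap : ∀ F : J → J → Fin N → ℝ, ∑ j, ∑ l, ∑ i ∈ bulk N, F j l i =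
        ∑ i ∈ bulk N, ∑ j, ∑ l, F j l i := by
      intro F
      rw [Finset.sum_comm]
      simp_rw [Finset.sum_comm (s := univ) (t := bulk N)]
      refine Finset.sum_congr rfl fun i _ => Finset.sum_comm
    rw [hswap]
    refine Finset.sum_congr rfl fun i _ => ?_
    simp only [ha₁, ha₂, ha₃, pow_two (∑ _, _), Finset.sum_mul_sum, ← Finset.sum_add_distrib]
    refine Finset.sum_congr rfl fun j _ => Finset.sum_congr rfl fun l _ => ?_
    have h1 : √t * √t = t := Real.mul_self_sqrt ht.1
    have h2 : √(1 - t) * √(1 - t) = 1 - t := Real.mul_self_sqrt (sub_nonneg.2 ht.2)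
    cases s j <;> cases s l <;> simp <;>
      first
      | linear_combination (k ^ 2 * (θ j * θ l * (ζ j i * ζ l i))) * h1 +
          (k ^ 2 * (θ j * θ l * (ζ j i * ζ l i))) * h2
      | linear_combination (k ^ 2 * (θ j * θ l * (ζ j i * ζ l i))) * h1
  simp only [hlin]
  rw [← hvar]
  exact exp_linear_disM3 N _ _ _

lemma abs_ovlpm_le_one (N : ℕ) (σ τ : Config N) : |ovlpm N σ τ| ≤ 1 := by
  rw [ovlpm, abs_div, Nat.abs_cast]
  refine div_le_one_of_le₀ ?_ (Nat.cast_nonneg _)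
  refine (Finset.abs_sum_le_sum_abs _ _).trans ?_
  simp only [abs_mul, abs_spin, mul_one, Finset.sum_const, nsmul_eq_mul]
  exact_mod_cast (Finset.card_le_univ _).trans_eq (Fintype.card_fin N)

/-- The variance of a cavity field. -/
def cavVar (N : ℕ) (β : ℝ) : ℝ := β ^ 2 * ((bulk N).card / N)

lemma ovlpm_self (N : ℕ) (σ : Config N) : ovlpm N σ σ = (bulk N).card / N := by
  simp [ovlpm, spin_sq, bulk]

lemma cavVar_le_one (N : ℕ) {β : ℝ} (hβ : β ∈ Set.Ioc (0 : ℝ) 1) : cavVar N β ≤ 1 := by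
  have h := abs_ovlpm_le_one N fun _ => true
  have h1 := (abs_le.1 (h fun _ => true)).2
  rw [ovlpm_self] at h1
  exact mul_le_one₀ (pow_le_one₀ hβ.1.le hβ.2) (by positivity) h1

lemma cavCov_self {N : ℕ} (hN : 0 < N) (β t : ℝ) {J : Type*} (η : J → Config N) (s : J → Bool)
    (j : J) : cavCov hN β t η s j j = cavVar N β := by
  simp [cavCov, spin_sq, ovlpm_self, cavVar]

lemma abs_cavCov_le {N : ℕ} (hN : 0 < N) {β t : ℝ} (hβ : β ∈ Set.Ioc (0 : ℝ) 1)
    (ht : t ∈ Set.Icc (0 : ℝ) 1) {J : Type*} (η : J → Config N) (s : J → Bool) (j k : J) :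
    |cavCov hN β t η s j k| ≤ |ovlpm N (η j) (η k)| := by
  have h1 : |if s j = s k then 1 else t| ≤ 1 := by
    split_ifs
    · simp
    · rw [abs_of_nonneg ht.1]; exact ht.2
  have h2 : |β ^ 2| ≤ 1 := by
    rw [abs_of_nonneg (sq_nonneg _)]; exact pow_le_one₀ hβ.1.le hβ.2
  simp only [cavCov, abs_mul, abs_spin, mul_one]
  calc |β ^ 2| * |ovlpm N (η j) (η k)| * |if s j = s k then 1 else t|
      ≤ 1 * |ovlpm N (η j) (η k)| * 1 := by gcongr
    _ = _ := by ring

/-- The cavity tilt `cosh(x) cosh(y)` obtained by averaging the cavity factor over the last spins. -/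
def cavTilt (N : ℕ) (β t : ℝ) (ρ : Config N × Config N)
    (ω : (Fin N × Fin N → ℝ) × (Fin N × Fin N → ℝ) × (Fin N × Fin N → ℝ)) : ℝ :=
  cosh (cavField N β t ω.1 ω.2.1 ρ.1) * cosh (cavField N β t ω.1 ω.2.2 ρ.2)

lemma one_le_cavTilt (N : ℕ) (β t : ℝ) (ρ : Config N × Config N)
    (ω : (Fin N × Fin N → ℝ) × (Fin N × Fin N → ℝ) × (Fin N × Fin N → ℝ)) :
    1 ≤ cavTilt N β t ρ ω :=
  one_le_mul_of_one_le_of_one_le (one_le_cosh _) (one_le_cosh _)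

/-- The six configurations contained in three replicas of the coupled system. -/
def replica {N : ℕ} (ρ : Fin 3 → Config N × Config N) (j : Fin 3 × Bool) : Config N :=
  if j.2 then (ρ j.1).1 else (ρ j.1).2

/-- The sum of all squared truncated overlaps between distinct configurations of three replicas. -/
def overlapSum {N : ℕ} (ρ : Fin 3 → Config N × Config N) : ℝ :=
  ∑ p ∈ (univ : Finset (Fin 3 × Bool)).offDiag, ovlpm N (replica ρ p.1) (replica ρ p.2) ^ 2

lemma cavTilt_moment {N : ℕ} (hN : 0 < N) {β t : ℝ} (hβ : β ∈ Set.Ioc (0 : ℝ) 1)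
    (ht : t ∈ Set.Icc (0 : ℝ) 1) (ρ : Fin 3 → Config N × Config N) (T : Fin 3 → Bool) :
    Integrable (fun ω => ∏ l, if T l then cavTilt N β t (ρ l) ω else 1) (disM3 N) ∧
      |(∫ ω, ∏ l, (if T l then cavTilt N β t (ρ l) ω else 1) ∂disM3 N) /
          (∏ l, if T l then exp (cavVar N β) else 1) - 1| ≤ exp 30 * 30 * overlapSum ρ := by
  set x := fun (j : Fin 3 × Bool)
      (ω : (Fin N × Fin N → ℝ) × (Fin N × Fin N → ℝ) × (Fin N × Fin N → ℝ)) =>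
    cavField N β t ω.1 (if j.2 then ω.2.1 else ω.2.2) (replica ρ j)
  have hG : HasGaussianMGF (disM3 N) x (cavCov hN β t (replica ρ) Prod.snd) :=
    hasGaussianMGF_cavField hN β ht (replica ρ) Prod.snd
  set u : Fin 3 × Bool → ℝ := fun j => if T j.1 then 1 else 0 with hu
  have hprod : ∀ ω, ∏ j, cosh (u j * x j ω) =
      ∏ l, if T l then cavTilt N β t (ρ l) ω else 1 := by
    intro ω
    rw [Fintype.prod_prod_type]
    refine Finset.prod_congr rfl fun l _ => ?_
    cases h : T l <;> simp [hu, x, h, cavTilt, replica]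
  have hnorm : exp (-(∑ j, u j ^ 2 * cavCov hN β t (replica ρ) Prod.snd j j) / 2) =
      (∏ l, if T l then exp (cavVar N β) else 1)⁻¹ := by
    simp only [cavCov_self]
    rw [Fintype.sum_prod_type, neg_div, exp_neg, Finset.sum_div, exp_sum]
    congr 1
    refine Finset.prod_congr rfl fun l _ => ?_
    cases h : T l <;> simp [hu, h]
  have h1 := hG.integrable_prod_cosh u
  have h2 := hG.abs_integral_prod_cosh_sub_one_le u
    (fun j => by simp only [hu]; split_ifs <;> simp)
    (fun j k => (abs_cavCov_le hN hβ ht _ _ j k).trans (abs_ovlpm_le_one _ _ _))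
  have hcard : (univ : Finset (Fin 3 × Bool)).offDiag.card = 30 := by decide
  simp only [hprod] at h1 h2
  rw [hnorm, hcard] at h2
  refine ⟨h1, ?_⟩
  rw [div_eq_inv_mul]
  refine h2.trans ?_
  push_cast
  refine mul_le_mul_of_nonneg_left (Finset.sum_le_sum fun p _ => ?_) (by positivity)
  exact sq_le_sq.2 (abs_cavCov_le hN hβ ht _ _ _ _)

lemma overlapSum_le {N : ℕ} (ρ : Fin 3 → Config N × Config N) : overlapSum ρ ≤ 30 := by
  have hcard : (univ : Finset (Fin 3 × Bool)).offDiag.card = 30 := by decide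
  refine (Finset.sum_le_card_nsmul _ _ 1 fun p _ => ?_).trans_eq (by rw [hcard]; norm_num)
  exact (sq_le_one_iff_abs_le_one _).2 (abs_ovlpm_le_one _ _ _)

end CavityField

section LastSpin

/-- Flip the last spin. -/
def flipLast {N : ℕ} (hN : 0 < N) (σ : Config N) : Config N :=
  Function.update σ (lastSite hN) (!σ (lastSite hN))

lemma flipLast_involutive {N : ℕ} (hN : 0 < N) : Function.Involutive (flipLast hN) := by
  intro σ
  simp [flipLast]

lemma flipLast_lastSite {N : ℕ} (hN : 0 < N) (σ : Config N) :
    flipLast hN σ (lastSite hN) = !σ (lastSite hN) := by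
  simp [flipLast]

lemma flipLast_of_lt {N : ℕ} (hN : 0 < N) (σ : Config N) {i : Fin N} (hi : (i : ℕ) < N - 1) :
    flipLast hN σ i = σ i := by
  refine Function.update_of_ne (fun h => ?_) _ _
  simp [h, lastSite] at hi

lemma hamCav_flipLast {N : ℕ} (hN : 0 < N) (β : ℝ) (g : Fin N × Fin N → ℝ) (σ : Config N) :
    hamCav N β g (flipLast hN σ) = hamCav N β g σ := by
  unfold hamCav
  congr 1
  refine Finset.sum_congr rfl fun p hp => ?_
  obtain ⟨h1, h2⟩ := (Finset.mem_filter.1 hp).2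
  rw [flipLast_of_lt hN σ h2, flipLast_of_lt hN σ ((Fin.lt_def.1 h1).trans h2)]

lemma ovlpm_flipLast_left {N : ℕ} (hN : 0 < N) (σ τ : Config N) :
    ovlpm N (flipLast hN σ) τ = ovlpm N σ τ := by
  unfold ovlpm
  congr 1
  refine Finset.sum_congr rfl fun i hi => ?_
  rw [flipLast_of_lt hN σ (Finset.mem_filter.1 hi).2]

lemma ovlpm_comm (N : ℕ) (σ τ : Config N) : ovlpm N σ τ = ovlpm N τ σ := by
  simp only [ovlpm, mul_comm]

lemma ovlpm_flipLast_right {N : ℕ} (hN : 0 < N) (σ τ : Config N) :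
    ovlpm N σ (flipLast hN τ) = ovlpm N σ τ := by
  rw [ovlpm_comm, ovlpm_flipLast_left, ovlpm_comm]

lemma cavField_flipLast {N : ℕ} (hN : 0 < N) (β t : ℝ) (g g' : Fin N × Fin N → ℝ)
    (σ : Config N) : cavField N β t g g' (flipLast hN σ) = -cavField N β t g g' σ := by
  rw [cavField_eq hN, cavField_eq hN, flipLast_lastSite, spin_not]
  have : ∀ i ∈ bulk N, flipLast hN σ i = σ i := fun i hi =>
    flipLast_of_lt hN σ (Finset.mem_filter.1 hi).2
  rw [Finset.sum_congr rfl fun i hi => by rw [this i hi]]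
  ring

/-- Averaging an odd exponent over an involution produces a hyperbolic cosine. -/
lemma sum_mul_exp_eq_sum_mul_cosh {S : Type*} [Fintype S] {φ : S → S}
    (hφ : Function.Involutive φ) {G x : S → ℝ} (hG : ∀ a, G (φ a) = G a)
    (hx : ∀ a, x (φ a) = -x a) : ∑ a, G a * exp (x a) = ∑ a, G a * cosh (x a) := by
  have h : ∑ a, G a * exp (-x a) = ∑ a, G a * exp (x a) := by
    rw [← Equiv.sum_comp hφ.toPerm]
    exact Finset.sum_congr rfl fun a _ => by simp [hG, hx]
  simp_rw [cosh_eq, mul_div_assoc', mul_add]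
  rw [← Finset.sum_div, Finset.sum_add_distrib, h]
  ring

/-- Averaging the cavity factor over the two last spins of the coupled system. -/
lemma sum_mul_exp_cavField {N : ℕ} (hN : 0 < N) (β t : ℝ) {G : Config N × Config N → ℝ}
    (h1 : ∀ σ τ, G (flipLast hN σ, τ) = G (σ, τ)) (h2 : ∀ σ τ, G (σ, flipLast hN τ) = G (σ, τ))
    (ω : (Fin N × Fin N → ℝ) × (Fin N × Fin N → ℝ) × (Fin N × Fin N → ℝ)) :
    ∑ ρ, G ρ * exp (cavField N β t ω.1 ω.2.1 ρ.1 + cavField N β t ω.1 ω.2.2 ρ.2) =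
      ∑ ρ, G ρ * cavTilt N β t ρ ω := by
  simp_rw [cavTilt, exp_add, Fintype.sum_prod_type]
  calc _ = ∑ σ, (∑ τ, G (σ, τ) * exp (cavField N β t ω.1 ω.2.2 τ)) *
        exp (cavField N β t ω.1 ω.2.1 σ) := by
        simp_rw [Finset.sum_mul]
        refine Finset.sum_congr rfl fun σ _ => Finset.sum_congr rfl fun τ _ => by ring
    _ = ∑ σ, (∑ τ, G (σ, τ) * cosh (cavField N β t ω.1 ω.2.2 τ)) *
        cosh (cavField N β t ω.1 ω.2.1 σ) := by
        have h3 : ∀ σ, ∑ τ, G (σ, τ) * exp (cavField N β t ω.1 ω.2.2 τ) =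
            ∑ τ, G (σ, τ) * cosh (cavField N β t ω.1 ω.2.2 τ) := fun σ =>
          sum_mul_exp_eq_sum_mul_cosh (flipLast_involutive hN) (G := fun τ => G (σ, τ)) (h2 σ)
            (cavField_flipLast hN β t ω.1 ω.2.2)
        simp_rw [h3]
        exact sum_mul_exp_eq_sum_mul_cosh (flipLast_involutive hN)
          (fun σ => by simp_rw [h1]) (cavField_flipLast hN β t ω.1 ω.2.1)
    _ = _ := by
        simp_rw [Finset.sum_mul]
        refine Finset.sum_congr rfl fun σ _ => Finset.sum_congr rfl fun τ _ => by ring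

end LastSpin

section CavityGibbs

/-- The interpolated couplings `√t g + √(1-t) g'`. -/
def interp {N : ℕ} (t : ℝ) (g g' : Fin N × Fin N → ℝ) (p : Fin N × Fin N) : ℝ :=
  √t * g p + √(1 - t) * g' p

/-- The Gibbs weights of the cavity Hamiltonian. -/
def cavWeight (N : ℕ) (β : ℝ) (g : Fin N × Fin N → ℝ) (σ : Config N) : ℝ :=
  exp (hamCav N β g σ) / ∑ τ, exp (hamCav N β g τ)

lemma sum_exp_pos {S : Type*} [Fintype S] [Nonempty S] (x : S → ℝ) : 0 < ∑ a, exp (x a) :=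
  Finset.sum_pos (fun _ _ => exp_pos _) univ_nonempty

lemma cavWeight_nonneg (N : ℕ) (β : ℝ) (g : Fin N × Fin N → ℝ) (σ : Config N) :
    0 ≤ cavWeight N β g σ := by
  unfold cavWeight; positivity

lemma sum_cavWeight (N : ℕ) (β : ℝ) (g : Fin N × Fin N → ℝ) : ∑ σ, cavWeight N β g σ = 1 := by
  simp_rw [cavWeight]
  rw [← Finset.sum_div, div_self (sum_exp_pos _).ne']

lemma cavWeight_flipLast {N : ℕ} (hN : 0 < N) (β : ℝ) (g : Fin N × Fin N → ℝ) (σ : Config N) :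
    cavWeight N β g (flipLast hN σ) = cavWeight N β g σ := by
  simp only [cavWeight, hamCav_flipLast]

lemma cavWeight_le_one (N : ℕ) (β : ℝ) (g : Fin N × Fin N → ℝ) (σ : Config N) :
    cavWeight N β g σ ≤ 1 := by
  rw [← sum_cavWeight N β g]
  exact Finset.single_le_sum (fun τ _ => cavWeight_nonneg N β g τ) (Finset.mem_univ σ)

lemma hamCav_interp (N : ℕ) (β t : ℝ) (g g' : Fin N × Fin N → ℝ) (σ : Config N) :
    hamCav N β (interp t g g') σ = √t * hamCav N β g σ + √(1 - t) * hamCav N β g' σ := by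
  simp only [hamCav, interp, Finset.mul_sum, ← Finset.sum_add_distrib]
  exact Finset.sum_congr rfl fun p _ => by ring

lemma hamCav_resample {N : ℕ} (β : ℝ) (z : (Fin N × Fin N → ℝ) × (Fin N × Fin N → ℝ))
    (σ : Config N) : hamCav N β (resample z) σ = hamCav N β z.1 σ := by
  unfold hamCav
  congr 1
  refine Finset.sum_congr rfl fun p hp => ?_
  rw [resample, if_pos (Finset.mem_filter.1 hp).2.2]

lemma cavField_resample {N : ℕ} (β t : ℝ) (z z' : (Fin N × Fin N → ℝ) × (Fin N × Fin N → ℝ))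
    (σ : Config N) :
    cavField N β t (resample z) (resample z') σ = cavField N β t z.2 z'.2 σ := by
  simp [cavField, resample]

/-- The Gibbs weights of the coupled cavity system. -/
def pairWeight (N : ℕ) (β t : ℝ)
    (ω : (Fin N × Fin N → ℝ) × (Fin N × Fin N → ℝ) × (Fin N × Fin N → ℝ))
    (ρ : Config N × Config N) : ℝ :=
  cavWeight N β (interp t ω.1 ω.2.1) ρ.1 * cavWeight N β (interp t ω.1 ω.2.2) ρ.2

variable {N : ℕ} {β t : ℝ}

lemma pairWeight_nonneg
    (ω : (Fin N × Fin N → ℝ) × (Fin N × Fin N → ℝ) × (Fin N × Fin N → ℝ))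
    (ρ : Config N × Config N) : 0 ≤ pairWeight N β t ω ρ :=
  mul_nonneg (cavWeight_nonneg _ _ _ _) (cavWeight_nonneg _ _ _ _)

lemma sum_pairWeight
    (ω : (Fin N × Fin N → ℝ) × (Fin N × Fin N → ℝ) × (Fin N × Fin N → ℝ)) :
    ∑ ρ, pairWeight N β t ω ρ = 1 := by
  simp only [pairWeight, Fintype.sum_prod_type, ← Finset.mul_sum, sum_cavWeight, mul_one]

lemma exp_hamCav_eq (ω : (Fin N × Fin N → ℝ) × (Fin N × Fin N → ℝ) × (Fin N × Fin N → ℝ))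
    (ρ : Config N × Config N) :
    exp (hamCav N β (interp t ω.1 ω.2.1) ρ.1 + hamCav N β (interp t ω.1 ω.2.2) ρ.2) =
      ((∑ τ, exp (hamCav N β (interp t ω.1 ω.2.1) τ)) *
        ∑ τ, exp (hamCav N β (interp t ω.1 ω.2.2) τ)) * pairWeight N β t ω ρ := by
  have h1 := (sum_exp_pos fun τ => hamCav N β (interp t ω.1 ω.2.1) τ).ne'
  have h2 := (sum_exp_pos fun τ => hamCav N β (interp t ω.1 ω.2.2) τ).ne'
  rw [pairWeight, cavWeight, cavWeight, exp_add]
  field_simp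

lemma gibbsTS1_zero (ω : (Fin N × Fin N → ℝ) × (Fin N × Fin N → ℝ) × (Fin N × Fin N → ℝ))
    (f : Config N × Config N → ℝ) :
    gibbsTS1 N β t 0 ω.1 ω.2.1 ω.2.2 f = ∑ ρ, pairWeight N β t ω ρ * f ρ := by
  set Z := (∑ τ, exp (hamCav N β (interp t ω.1 ω.2.1) τ)) *
    ∑ τ, exp (hamCav N β (interp t ω.1 ω.2.2) τ) with hZdef
  have hw : ∀ ρ, wTS N β t 0 ω.1 ω.2.1 ω.2.2 ρ = Z * pairWeight N β t ω ρ := fun ρ => by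
    rw [hZdef, ← exp_hamCav_eq]
    simp [wTS, hamTS, hamCav_interp]
  have hZ : Z ≠ 0 := (mul_pos (sum_exp_pos _) (sum_exp_pos _)).ne'
  simp only [gibbsTS1, hw]
  rw [← Finset.mul_sum, sum_pairWeight, mul_one, div_eq_iff hZ, Finset.sum_mul]
  exact Finset.sum_congr rfl fun ρ _ => by ring

lemma gibbsTS1_one_resampleTriple (hN : 0 < N)
    (z : ((Fin N × Fin N → ℝ) × (Fin N × Fin N → ℝ) × (Fin N × Fin N → ℝ)) ×
      ((Fin N × Fin N → ℝ) × (Fin N × Fin N → ℝ) × (Fin N × Fin N → ℝ)))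
    {f : Config N × Config N → ℝ}
    (h1 : ∀ σ τ, f (flipLast hN σ, τ) = f (σ, τ)) (h2 : ∀ σ τ, f (σ, flipLast hN τ) = f (σ, τ)) :
    gibbsTS1 N β t 1 (resampleTriple z).1 (resampleTriple z).2.1 (resampleTriple z).2.2 f =
      (∑ ρ, pairWeight N β t z.1 ρ * f ρ * cavTilt N β t ρ z.2) /
        ∑ ρ, pairWeight N β t z.1 ρ * cavTilt N β t ρ z.2 := by
  set Z := (∑ τ, exp (hamCav N β (interp t z.1.1 z.1.2.1) τ)) *
    ∑ τ, exp (hamCav N β (interp t z.1.1 z.1.2.2) τ) with hZdef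
  have hw : ∀ ρ, wTS N β t 1 (resampleTriple z).1 (resampleTriple z).2.1 (resampleTriple z).2.2 ρ =
      Z * (pairWeight N β t z.1 ρ *
        exp (cavField N β t z.2.1 z.2.2.1 ρ.1 + cavField N β t z.2.1 z.2.2.2 ρ.2)) := fun ρ => by
    rw [← mul_assoc, hZdef, ← exp_hamCav_eq, ← exp_add]
    simp only [wTS, hamTS, resampleTriple, hamCav_resample, cavField_resample, hamCav_interp,
      sqrt_one, one_mul]
    congr 1
    ring
  have hZ : Z ≠ 0 := (mul_pos (sum_exp_pos _) (sum_exp_pos _)).ne'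
  have hp1 : ∀ σ τ, pairWeight N β t z.1 (flipLast hN σ, τ) = pairWeight N β t z.1 (σ, τ) :=
    fun σ τ => by simp only [pairWeight, cavWeight_flipLast]
  have hp2 : ∀ σ τ, pairWeight N β t z.1 (σ, flipLast hN τ) = pairWeight N β t z.1 (σ, τ) :=
    fun σ τ => by simp only [pairWeight, cavWeight_flipLast]
  rw [← sum_mul_exp_cavField hN β t hp1 hp2,
    ← sum_mul_exp_cavField hN β t (G := fun ρ => pairWeight N β t z.1 ρ * f ρ)
      (fun σ τ => by rw [hp1, h1]) (fun σ τ => by rw [hp2, h2])]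
  simp only [gibbsTS1, hw]
  rw [← Finset.mul_sum, ← mul_div_mul_left (∑ ρ, _ * f ρ * _) _ hZ]
  congr 1
  rw [Finset.mul_sum]
  exact Finset.sum_congr rfl fun ρ _ => by ring

lemma measurable_gibbsTS1 (s : ℝ) (f : Config N × Config N → ℝ) :
    Measurable fun ω : (Fin N × Fin N → ℝ) × (Fin N × Fin N → ℝ) × (Fin N × Fin N → ℝ) =>
      gibbsTS1 N β t s ω.1 ω.2.1 ω.2.2 f := by
  by_cases h : 0 < N
  · simp only [gibbsTS1, wTS, hamTS, hamCav, cavField, h, dif_pos]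
    fun_prop
  · simp only [gibbsTS1, wTS, hamTS, hamCav, cavField, h, dif_neg, not_false_eq_true]
    fun_prop

lemma abs_gibbsTS1_le (s : ℝ) (g g' g'' : Fin N × Fin N → ℝ) (f : Config N × Config N → ℝ) :
    |gibbsTS1 N β t s g g' g'' f| ≤ ∑ ρ, |f ρ| := by
  have hZ : 0 < ∑ ρ, wTS N β t s g g' g'' ρ := sum_exp_pos _
  rw [gibbsTS1, abs_div, abs_of_pos hZ, div_le_iff₀ hZ, Finset.sum_mul]
  refine (Finset.abs_sum_le_sum_abs _ _).trans (Finset.sum_le_sum fun ρ _ => ?_)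
  have hw : ∀ ρ', 0 ≤ wTS N β t s g g' g'' ρ' := fun _ => (exp_pos _).le
  rw [abs_mul, abs_of_nonneg (hw ρ)]
  exact mul_le_mul_of_nonneg_left (Finset.single_le_sum (fun ρ' _ => hw ρ') (Finset.mem_univ ρ))
    (abs_nonneg _)

lemma integrable_gibbsTS1 (s : ℝ) (f : Config N × Config N → ℝ) :
    Integrable (fun ω => gibbsTS1 N β t s ω.1 ω.2.1 ω.2.2 f) (disM3 N) :=
  Integrable.of_bound (measurable_gibbsTS1 s f).aestronglyMeasurable (∑ ρ, |f ρ|)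
    (Eventually.of_forall fun _ => abs_gibbsTS1_le s _ _ _ f)

lemma EgibbsTS1_zero (f : Config N × Config N → ℝ) :
    EgibbsTS1 N β t 0 f = ∫ ω, ∑ ρ, pairWeight N β t ω ρ * f ρ ∂disM3 N :=
  integral_congr_ae (Eventually.of_forall fun ω => gibbsTS1_zero ω f)

/-- The full average, conditioned on the couplings of the cavity system. -/
lemma EgibbsTS1_one (hN : 0 < N) {f : Config N × Config N → ℝ}
    (h1 : ∀ σ τ, f (flipLast hN σ, τ) = f (σ, τ)) (h2 : ∀ σ τ, f (σ, flipLast hN τ) = f (σ, τ)) :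
    Integrable (fun ω => ∫ ω', (∑ ρ, pairWeight N β t ω ρ * f ρ * cavTilt N β t ρ ω') /
        ∑ ρ, pairWeight N β t ω ρ * cavTilt N β t ρ ω' ∂disM3 N) (disM3 N) ∧
    EgibbsTS1 N β t 1 f =
      ∫ ω, ∫ ω', (∑ ρ, pairWeight N β t ω ρ * f ρ * cavTilt N β t ρ ω') /
        ∑ ρ, pairWeight N β t ω ρ * cavTilt N β t ρ ω' ∂disM3 N ∂disM3 N := by
  have hφ := measurePreserving_resampleTriple N
  have hint := hφ.integrable_comp_of_integrable (integrable_gibbsTS1 (β := β) (t := t) 1 f)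
  simp only [Function.comp_def, gibbsTS1_one_resampleTriple hN _ h1 h2] at hint
  refine ⟨hint.integral_prod_left, ?_⟩
  rw [EgibbsTS1, integral_eq_of_measurePreserving hφ (measurable_gibbsTS1 1 f)]
  simp only [gibbsTS1_one_resampleTriple hN _ h1 h2]
  exact integral_prod _ hint

end CavityGibbs

section Gram

variable {N : ℕ}

/-- The fourth power of an unnormalized overlap is a Gram kernel. -/
lemma sum_sum_mul_overlap_pow_four (s : Finset (Fin N)) (v w : Config N → ℝ) :
    ∑ σ, ∑ τ, v σ * w τ * (∑ i ∈ s, spin (σ i) * spin (τ i)) ^ 4 =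
      ∑ p ∈ Fintype.piFinset fun _ : Fin 4 => s,
        (∑ σ, v σ * ∏ k, spin (σ (p k))) * ∑ τ, w τ * ∏ k, spin (τ (p k)) := by
  simp_rw [Finset.sum_mul_sum, Finset.sum_pow', Finset.mul_sum, Finset.prod_mul_distrib]
  rw [Finset.sum_congr rfl fun σ _ => Finset.sum_comm, Finset.sum_comm]
  refine Finset.sum_congr rfl fun p _ => Finset.sum_congr rfl fun σ _ =>
    Finset.sum_congr rfl fun τ _ => by ring

lemma sum_sum_mul_ovlpm_pow_four (v w : Config N → ℝ) :
    ∑ σ, ∑ τ, v σ * w τ * ovlpm N σ τ ^ 4 =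
      (∑ p ∈ Fintype.piFinset fun _ : Fin 4 => bulk N,
        (∑ σ, v σ * ∏ k, spin (σ (p k))) * ∑ τ, w τ * ∏ k, spin (τ (p k))) / N ^ 4 := by
  rw [← sum_sum_mul_overlap_pow_four]
  simp_rw [Finset.sum_div, ovlpm, bulk, div_pow, mul_div_assoc]

/-- The averaged fourth power of the truncated overlap between two independent systems is at most
the mean of its averages within each system. -/
lemma sum_sum_ovlpm_pow_four_le (v w : Config N → ℝ) :
    ∑ σ, ∑ τ, v σ * w τ * ovlpm N σ τ ^ 4 ≤
      (∑ σ, ∑ τ, v σ * v τ * ovlpm N σ τ ^ 4 + ∑ σ, ∑ τ, w σ * w τ * ovlpm N σ τ ^ 4) / 2 := by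
  simp_rw [sum_sum_mul_ovlpm_pow_four]
  rw [← add_div, div_right_comm, ← Finset.sum_add_distrib]
  refine div_le_div_of_nonneg_right ?_ (by positivity)
  rw [Finset.sum_div]
  refine Finset.sum_le_sum fun p _ => ?_
  linarith [two_mul_le_add_sq (∑ σ, v σ * ∏ k, spin (σ (p k))) (∑ τ, w τ * ∏ k, spin (τ (p k)))]

lemma inv_pow_four_le_sum_sum_ovlp (hN : 0 < N) {v : Config N → ℝ} (hv : ∑ σ, v σ = 1) :
    1 / (N : ℝ) ^ 4 ≤ ∑ σ, ∑ τ, v σ * v τ * ovlp N σ τ ^ 4 := by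
  simp_rw [ovlp, div_pow, mul_div_assoc', ← Finset.sum_div]
  refine div_le_div_of_nonneg_right ?_ (by positivity)
  rw [sum_sum_mul_overlap_pow_four]
  have h : ∀ σ : Config N, ∏ _k : Fin 4, spin (σ (lastSite hN)) = 1 := fun σ => by
    rw [Finset.prod_const, Finset.card_univ, Fintype.card_fin,
      show 4 = 2 * 2 from rfl, pow_mul, pow_two (spin _), spin_sq, one_pow]
  refine le_trans ?_ (Finset.single_le_sum (f := fun p : Fin 4 → Fin N =>
    (∑ σ, v σ * ∏ k, spin (σ (p k))) * ∑ τ, v τ * ∏ k, spin (τ (p k)))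
    (fun p _ => mul_self_nonneg _) (a := fun _ => lastSite hN) (by simp))
  simp [h, hv]

lemma ovlp_eq (hN : 0 < N) (σ τ : Config N) :
    ovlp N σ τ = ovlpm N σ τ + spin (σ (lastSite hN)) * spin (τ (lastSite hN)) / N := by
  have h : (univ : Finset (Fin N)) = insert (lastSite hN) (bulk N) := by
    ext i
    have := i.2
    simp only [Finset.mem_univ, Finset.mem_insert, bulk, lastSite, Finset.mem_filter, true_and,
      true_iff, Fin.ext_iff]
    lia
  rw [ovlp, h, Finset.sum_insert (lastSite_notMem_bulk hN), add_div, add_comm]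
  rfl

lemma ovlpm_pow_four_le (hN : 0 < N) (σ τ : Config N) :
    ovlpm N σ τ ^ 4 ≤ 8 * (ovlp N σ τ ^ 4 + 1 / (N : ℝ) ^ 4) := by
  have h4 : (spin (σ (lastSite hN)) * spin (τ (lastSite hN)) / (N : ℝ)) ^ 4 = 1 / (N : ℝ) ^ 4 := by
    rw [div_pow, mul_pow]
    have h : ∀ b, spin b ^ 4 = 1 := fun b => by cases b <;> norm_num [spin]
    rw [h, h, one_mul]
  have h := ovlp_eq hN σ τ
  set x := spin (σ (lastSite hN)) * spin (τ (lastSite hN)) / (N : ℝ)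
  rw [← h4, show ovlpm N σ τ = ovlp N σ τ - x by linarith]
  generalize ovlp N σ τ = y
  nlinarith [sq_nonneg (y + x), sq_nonneg (y ^ 2 - x ^ 2), sq_nonneg (y - x),
    mul_nonneg (sq_nonneg (y + x)) (sq_nonneg (y - x)), sq_nonneg ((y + x) ^ 2),
    mul_nonneg (sq_nonneg (y + x)) (sq_nonneg y), mul_nonneg (sq_nonneg (y + x)) (sq_nonneg x)]

lemma sum_sum_ovlpm_pow_four_le_ovlp (hN : 0 < N) {v : Config N → ℝ} (hv0 : ∀ σ, 0 ≤ v σ)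
    (hv : ∑ σ, v σ = 1) :
    ∑ σ, ∑ τ, v σ * v τ * ovlpm N σ τ ^ 4 ≤ 16 * ∑ σ, ∑ τ, v σ * v τ * ovlp N σ τ ^ 4 := by
  have h1 : ∑ σ, ∑ τ, v σ * v τ * (8 * (ovlp N σ τ ^ 4 + 1 / (N : ℝ) ^ 4)) =
      8 * (∑ σ, ∑ τ, v σ * v τ * ovlp N σ τ ^ 4 + 1 / (N : ℝ) ^ 4) := by
    have h2 : ∑ σ, ∑ τ, v σ * v τ * (1 / (N : ℝ) ^ 4) = 1 / (N : ℝ) ^ 4 := by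
      simp_rw [← Finset.sum_mul, ← Finset.mul_sum, hv, mul_one, hv, one_mul]
    nth_rewrite 2 [← h2]
    simp_rw [← Finset.sum_add_distrib, Finset.mul_sum]
    exact Finset.sum_congr rfl fun σ _ => Finset.sum_congr rfl fun τ _ => by ring
  have h3 : ∑ σ, ∑ τ, v σ * v τ * ovlpm N σ τ ^ 4 ≤ _ :=
    (Finset.sum_le_sum fun σ _ => Finset.sum_le_sum fun τ _ =>
      mul_le_mul_of_nonneg_left (ovlpm_pow_four_le hN σ τ) (mul_nonneg (hv0 σ) (hv0 τ))).trans_eq h1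
  linarith [inv_pow_four_le_sum_sum_ovlp hN hv]

end Gram

section FullSystem

variable {N : ℕ} {β : ℝ}

lemma ham_eq (hN : 0 < N) (g g' : Fin N × Fin N → ℝ) (σ : Config N) :
    ham N β g σ = hamTS N β 1 1 g g' σ := by
  rw [hamTS, cavField_eq hN, ham, hamCav]
  simp only [sqrt_one, one_mul, sub_self, sqrt_zero, zero_mul, add_zero]
  rw [mul_assoc, ← mul_add]
  congr 1
  have h : (univ.filter fun p : Fin N × Fin N => p.1 < p.2) =
      (univ.filter fun p : Fin N × Fin N => p.1 < p.2 ∧ (p.2 : ℕ) < N - 1) ∪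
        (bulk N).map ⟨fun i => (i, lastSite hN), fun i j h => (Prod.ext_iff.1 h).1⟩ := by
    ext ⟨i, j⟩
    have := i.2
    have := j.2
    simp only [Finset.mem_filter, Finset.mem_univ, true_and, Finset.mem_union, Finset.mem_map, bulk,
      Function.Embedding.coeFn_mk, Prod.mk.injEq, lastSite, Fin.lt_def]
    constructor
    · intro h
      by_cases hj : (j : ℕ) < N - 1
      · exact .inl ⟨h, hj⟩
      · exact .inr ⟨i, by lia, rfl, Fin.ext (by simp only; lia)⟩
    · rintro (h | ⟨k, hk, rfl, rfl⟩)
      · exact h.1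
      · exact hk
  have hd : Disjoint (univ.filter fun p : Fin N × Fin N => p.1 < p.2 ∧ (p.2 : ℕ) < N - 1)
      ((bulk N).map ⟨fun i => (i, lastSite hN), fun i j h => (Prod.ext_iff.1 h).1⟩) := by
    rw [Finset.disjoint_left]
    rintro p hp hp'
    obtain ⟨i, -, rfl⟩ := Finset.mem_map.1 hp'
    simp [lastSite] at hp
  rw [h, Finset.sum_union hd, Finset.sum_map, Finset.mul_sum]
  congr 1
  exact Finset.sum_congr rfl fun i _ => by
    change g (i, lastSite hN) * spin (σ i) * spin (σ (lastSite hN)) = _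
    ring

lemma gibbs2_eq (g : Fin N × Fin N → ℝ) (f : Config N → Config N → ℝ) :
    gibbs2 N β g f = ∑ σ, ∑ τ, (exp (ham N β g σ) / partFun N β g) *
      (exp (ham N β g τ) / partFun N β g) * f σ τ := by
  rw [gibbs2, Finset.sum_div]
  simp_rw [Finset.sum_div, exp_add]
  exact Finset.sum_congr rfl fun σ _ => Finset.sum_congr rfl fun τ _ => by ring

lemma gibbsTS1_one_one (hN : 0 < N) (g g' g'' : Fin N × Fin N → ℝ)
    (f : Config N → Config N → ℝ) :
    gibbsTS1 N β 1 1 g g' g'' (fun ρ => f ρ.1 ρ.2) = gibbs2 N β g f := by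
  simp only [gibbsTS1, wTS, ← ham_eq hN, gibbs2, partFun, Fintype.sum_prod_type, exp_add]
  congr 1
  rw [pow_two, Finset.sum_mul_sum]

lemma EgibbsTS1_one_one (hN : 0 < N) (f : Config N → Config N → ℝ) :
    EgibbsTS1 N β 1 1 (fun ρ => f ρ.1 ρ.2) = Egibbs2 N β f := by
  have hm : Measurable fun g => gibbs2 N β g f := by
    simp only [gibbs2, partFun, ham]
    fun_prop
  rw [Egibbs2, integral_eq_of_measurePreserving (μ := disM3 N) measurePreserving_fst hm]
  simp only [EgibbsTS1, gibbsTS1_one_one hN]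

lemma gibbs2_ovlpm_pow_four_le (hN : 0 < N) (g : Fin N × Fin N → ℝ) :
    gibbs2 N β g (fun σ τ => ovlpm N σ τ ^ 4) ≤ 16 * gibbs2 N β g (fun σ τ => ovlp N σ τ ^ 4) := by
  have hZ : 0 < partFun N β g := sum_exp_pos _
  rw [gibbs2_eq, gibbs2_eq]
  refine sum_sum_ovlpm_pow_four_le_ovlp hN (fun σ => by positivity) ?_
  rw [← Finset.sum_div]
  exact div_self hZ.ne'

lemma EgibbsTS1_ovlpm_pow_four_le (hN : 0 < N) :
    EgibbsTS1 N β 1 1 (fun ρ => ovlpm N ρ.1 ρ.2 ^ 4) ≤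
      16 * Egibbs2 N β (fun σ τ => ovlp N σ τ ^ 4) := by
  rw [← EgibbsTS1_one_one hN, EgibbsTS1, EgibbsTS1, ← integral_const_mul]
  refine integral_mono (integrable_gibbsTS1 _ _) ((integrable_gibbsTS1 _ _).const_mul _) fun ω => ?_
  have h1 := gibbsTS1_one_one (β := β) hN ω.1 ω.2.1 ω.2.2 fun σ τ => ovlpm N σ τ ^ 4
  have h2 := gibbsTS1_one_one (β := β) hN ω.1 ω.2.1 ω.2.2 fun σ τ => ovlp N σ τ ^ 4
  simp only [h1, h2]
  exact gibbs2_ovlpm_pow_four_le hN ω.1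

end FullSystem

section Comparison

variable {N : ℕ} {β t : ℝ}

/-- The two-replica average of the fourth power of the truncated overlap in the cavity system. -/
def cavFourth (N : ℕ) (β : ℝ) (g : Fin N × Fin N → ℝ) : ℝ :=
  ∑ σ, ∑ τ, cavWeight N β g σ * cavWeight N β g τ * ovlpm N σ τ ^ 4

lemma ovlpm_pow_four_nonneg (σ τ : Config N) : 0 ≤ ovlpm N σ τ ^ 4 :=
  Even.pow_nonneg (by decide) _

lemma cavFourth_nonneg (g : Fin N × Fin N → ℝ) : 0 ≤ cavFourth N β g :=
  Finset.sum_nonneg fun σ _ => Finset.sum_nonneg fun τ _ =>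
    mul_nonneg (mul_nonneg (cavWeight_nonneg _ _ _ _) (cavWeight_nonneg _ _ _ _))
      (ovlpm_pow_four_nonneg σ τ)

lemma measurable_cavFourth : Measurable fun g => cavFourth N β g := by
  unfold cavFourth cavWeight hamCav
  fun_prop

lemma cavFourth_le (g : Fin N × Fin N → ℝ) :
    cavFourth N β g ≤ ∑ σ : Config N, ∑ τ : Config N, ovlpm N σ τ ^ 4 :=
  Finset.sum_le_sum fun σ _ => Finset.sum_le_sum fun τ _ =>
    mul_le_of_le_one_left (ovlpm_pow_four_nonneg σ τ)
      (mul_le_one₀ (cavWeight_le_one _ _ _ _) (cavWeight_nonneg _ _ _ _) (cavWeight_le_one _ _ _ _))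

lemma sum_pairWeight_mul
    (ω : (Fin N × Fin N → ℝ) × (Fin N × Fin N → ℝ) × (Fin N × Fin N → ℝ))
    (F : Config N × Config N → ℝ) :
    ∑ ρ, pairWeight N β t ω ρ * F ρ = ∑ σ, cavWeight N β (interp t ω.1 ω.2.1) σ *
      ∑ τ, cavWeight N β (interp t ω.1 ω.2.2) τ * F (σ, τ) := by
  simp_rw [pairWeight, Fintype.sum_prod_type, Finset.mul_sum, mul_assoc]

/-- The three-replica average of the fourth power of any truncated overlap between distinct
configurations is controlled by the two-replica averages within each of the two systems. -/
lemma sum_replica_ovlpm_pow_four_le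
    (ω : (Fin N × Fin N → ℝ) × (Fin N × Fin N → ℝ) × (Fin N × Fin N → ℝ))
    {j k : Fin 3 × Bool} (hjk : j ≠ k) :
    ∑ a, ∑ b, ∑ c, pairWeight N β t ω a * pairWeight N β t ω b * pairWeight N β t ω c *
        ovlpm N (replica ![a, b, c] j) (replica ![a, b, c] k) ^ 4 ≤
      cavFourth N β (interp t ω.1 ω.2.1) + cavFourth N β (interp t ω.1 ω.2.2) := by
  simp_rw [mul_assoc, ← Finset.mul_sum, sum_pairWeight_mul]
  have hW1 := cavFourth_nonneg (β := β) (interp t ω.1 ω.2.1)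
  have hW2 := cavFourth_nonneg (β := β) (interp t ω.1 ω.2.2)
  have hv := sum_cavWeight N β (interp t ω.1 ω.2.1)
  have hw := sum_cavWeight N β (interp t ω.1 ω.2.2)
  have h11 := sum_sum_ovlpm_pow_four_le (cavWeight N β (interp t ω.1 ω.2.1))
    (cavWeight N β (interp t ω.1 ω.2.1))
  have h12 := sum_sum_ovlpm_pow_four_le (cavWeight N β (interp t ω.1 ω.2.1))
    (cavWeight N β (interp t ω.1 ω.2.2))
  have h21 := sum_sum_ovlpm_pow_four_le (cavWeight N β (interp t ω.1 ω.2.2))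
    (cavWeight N β (interp t ω.1 ω.2.1))
  have h22 := sum_sum_ovlpm_pow_four_le (cavWeight N β (interp t ω.1 ω.2.2))
    (cavWeight N β (interp t ω.1 ω.2.2))
  unfold cavFourth at *
  set v := cavWeight N β (interp t ω.1 ω.2.1)
  set w := cavWeight N β (interp t ω.1 ω.2.2)
  have hv' : ∀ x : ℝ, ∑ σ, v σ * x = x := fun x => by rw [← Finset.sum_mul, hv, one_mul]
  have hw' : ∀ x : ℝ, ∑ σ, w σ * x = x := fun x => by rw [← Finset.sum_mul, hw, one_mul]
  have key : ∀ x y : Config N → ℝ, ∑ σ, ∑ τ, x σ * y τ * ovlpm N σ τ ^ 4 =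
      ∑ σ, x σ * ∑ τ, y τ * ovlpm N σ τ ^ 4 := fun x y => by
    simp_rw [Finset.mul_sum, mul_assoc]
  have key' : ∀ x y : Config N → ℝ, ∑ σ, ∑ τ, x σ * y τ * ovlpm N σ τ ^ 4 =
      ∑ σ, x σ * ∑ τ, y τ * ovlpm N τ σ ^ 4 := fun x y => by
    simp_rw [key, ovlpm_comm]
  obtain ⟨l, b⟩ := j
  obtain ⟨l', b'⟩ := k
  fin_cases l <;> fin_cases l' <;> cases b <;> cases b' <;>
    first
    | exact absurd rfl hjk
    | (simp [replica, hv', hw']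
       first
       | (rw [← key]; linarith)
       | (rw [← key']; linarith))

/-- The averaged fourth power of the truncated overlap in the cavity system. -/
def EcavFourth (N : ℕ) (β : ℝ) : ℝ := ∫ g, cavFourth N β g ∂gaussPi N

lemma integrable_cavFourth (μ : Measure (Fin N × Fin N → ℝ)) [IsFiniteMeasure μ] :
    Integrable (fun g => cavFourth N β g) μ :=
  Integrable.of_bound measurable_cavFourth.aestronglyMeasurable _
    (Eventually.of_forall fun g => by
      rw [Real.norm_of_nonneg (cavFourth_nonneg g)]; exact cavFourth_le g)

lemma cavFourth_interp {φ : (Fin N × Fin N → ℝ) × (Fin N × Fin N → ℝ) × (Fin N × Fin N → ℝ) →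
      (Fin N × Fin N → ℝ) × (Fin N × Fin N → ℝ)}
    (ht : t ∈ Set.Icc (0 : ℝ) 1)
    (hφ : MeasurePreserving φ (disM3 N) ((gaussPi N).prod (gaussPi N))) :
    Integrable (fun ω => cavFourth N β (interp t (φ ω).1 (φ ω).2)) (disM3 N) ∧
      ∫ ω, cavFourth N β (interp t (φ ω).1 (φ ω).2) ∂disM3 N = EcavFourth N β := by
  have h := (measurePreserving_interpolation N ht).comp hφ
  exact ⟨h.integrable_comp_of_integrable (integrable_cavFourth _),
    (integral_eq_of_measurePreserving h measurable_cavFourth).symm⟩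

lemma cavFourth_interp_fst (ht : t ∈ Set.Icc (0 : ℝ) 1) :
    Integrable (fun ω => cavFourth N β (interp t ω.1 ω.2.1)) (disM3 N) ∧
      ∫ ω, cavFourth N β (interp t ω.1 ω.2.1) ∂disM3 N = EcavFourth N β := by
  have hφ : MeasurePreserving
      (fun ω : (Fin N × Fin N → ℝ) × (Fin N × Fin N → ℝ) × (Fin N × Fin N → ℝ) => (ω.1, ω.2.1))
      (disM3 N) ((gaussPi N).prod (gaussPi N)) :=
    (MeasurePreserving.id (gaussPi N)).prod
      (measurePreserving_fst (μ := gaussPi N) (ν := gaussPi N))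
  have h := cavFourth_interp (β := β) ht hφ
  exact h

lemma cavFourth_interp_snd (ht : t ∈ Set.Icc (0 : ℝ) 1) :
    Integrable (fun ω => cavFourth N β (interp t ω.1 ω.2.2)) (disM3 N) ∧
      ∫ ω, cavFourth N β (interp t ω.1 ω.2.2) ∂disM3 N = EcavFourth N β := by
  have hφ : MeasurePreserving
      (fun ω : (Fin N × Fin N → ℝ) × (Fin N × Fin N → ℝ) × (Fin N × Fin N → ℝ) => (ω.1, ω.2.2))
      (disM3 N) ((gaussPi N).prod (gaussPi N)) :=
    (MeasurePreserving.id (gaussPi N)).prod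
      (measurePreserving_snd (μ := gaussPi N) (ν := gaussPi N))
  have h := cavFourth_interp (β := β) ht hφ
  exact h

lemma cavTilt_moment_one (hN : 0 < N) (hβ : β ∈ Set.Ioc (0 : ℝ) 1) (ht : t ∈ Set.Icc (0 : ℝ) 1)
    (a b c : Config N × Config N) :
    Integrable (fun ω => cavTilt N β t a ω) (disM3 N) ∧
      |(∫ ω, cavTilt N β t a ω ∂disM3 N) / exp (cavVar N β) - 1| ≤
        exp 30 * 30 * overlapSum ![a, b, c] := by
  simpa [Fin.prod_univ_three] using cavTilt_moment hN hβ ht ![a, b, c] ![true, false, false]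

lemma cavTilt_moment_two (hN : 0 < N) (hβ : β ∈ Set.Ioc (0 : ℝ) 1) (ht : t ∈ Set.Icc (0 : ℝ) 1)
    (a b c : Config N × Config N) :
    Integrable (fun ω => cavTilt N β t a ω * cavTilt N β t b ω) (disM3 N) ∧
      |(∫ ω, cavTilt N β t a ω * cavTilt N β t b ω ∂disM3 N) / exp (cavVar N β) ^ 2 - 1| ≤
        exp 30 * 30 * overlapSum ![a, b, c] := by
  simpa [Fin.prod_univ_three, pow_two] using
    cavTilt_moment hN hβ ht ![a, b, c] ![true, true, false]

lemma cavTilt_moment_two_skip (hN : 0 < N) (hβ : β ∈ Set.Ioc (0 : ℝ) 1)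
    (ht : t ∈ Set.Icc (0 : ℝ) 1) (a b c : Config N × Config N) :
      |(∫ ω, cavTilt N β t a ω * cavTilt N β t c ω ∂disM3 N) / exp (cavVar N β) ^ 2 - 1| ≤
        exp 30 * 30 * overlapSum ![a, b, c] := by
  simpa [Fin.prod_univ_three, pow_two] using
    (cavTilt_moment hN hβ ht ![a, b, c] ![true, false, true]).2

lemma cavTilt_moment_three (hN : 0 < N) (hβ : β ∈ Set.Ioc (0 : ℝ) 1) (ht : t ∈ Set.Icc (0 : ℝ) 1)
    (a b c : Config N × Config N) :
    Integrable (fun ω => cavTilt N β t a ω * cavTilt N β t b ω * cavTilt N β t c ω) (disM3 N) ∧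
      |(∫ ω, cavTilt N β t a ω * cavTilt N β t b ω * cavTilt N β t c ω ∂disM3 N) /
          exp (cavVar N β) ^ 3 - 1| ≤ exp 30 * 30 * overlapSum ![a, b, c] := by
  simpa [Fin.prod_univ_three, pow_succ] using
    cavTilt_moment hN hβ ht ![a, b, c] ![true, true, true]

lemma exp_cavVar_le (hβ : β ∈ Set.Ioc (0 : ℝ) 1) : exp (cavVar N β) ≤ exp 1 :=
  exp_le_exp.2 (cavVar_le_one N hβ)

lemma integral_cavTilt_le (hN : 0 < N) (hβ : β ∈ Set.Ioc (0 : ℝ) 1) (ht : t ∈ Set.Icc (0 : ℝ) 1)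
    (a : Config N × Config N) :
    ∫ ω, cavTilt N β t a ω ∂disM3 N ≤ (1 + exp 30 * 30 * 30) * exp 1 := by
  have h := (le_abs_self _).trans (cavTilt_moment_one hN hβ ht a a a).2
  have h2 := mul_le_mul_of_nonneg_left (overlapSum_le ![a, a, a])
    (show (0 : ℝ) ≤ exp 30 * 30 by positivity)
  have h3 : (∫ ω, cavTilt N β t a ω ∂disM3 N) / exp (cavVar N β) ≤ 1 + exp 30 * 30 * 30 := by
    linarith
  rw [div_le_iff₀ (exp_pos _)] at h3
  exact h3.trans (mul_le_mul_of_nonneg_left (exp_cavVar_le hβ) (by positivity))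

lemma EcavFourth_le (hN : 0 < N) (hβ : β ∈ Set.Ioc (0 : ℝ) 1) :
    EcavFourth N β ≤ (1 + exp 30 * 30 * 30) * exp 1 *
      EgibbsTS1 N β 1 1 (fun ρ => ovlpm N ρ.1 ρ.2 ^ 4) := by
  have ht : (1 : ℝ) ∈ Set.Icc (0 : ℝ) 1 := ⟨zero_le_one, le_rfl⟩
  obtain ⟨hi, he⟩ := EgibbsTS1_one (β := β) (t := 1) hN
    (f := fun ρ => ovlpm N ρ.1 ρ.2 ^ 4) (fun σ τ => by simp only [ovlpm_flipLast_left])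
    (fun σ τ => by simp only [ovlpm_flipLast_right])
  obtain ⟨hi', he'⟩ := cavFourth_interp_fst (N := N) (β := β) ht
  rw [he, ← he', ← integral_const_mul]
  refine integral_mono hi' (hi.const_mul _) fun ω => ?_
  have hW : cavFourth N β (interp 1 ω.1 ω.2.1) =
      ∑ ρ, pairWeight N β 1 ω ρ * ovlpm N ρ.1 ρ.2 ^ 4 := by
    have h2 : interp 1 ω.1 ω.2.2 = interp 1 ω.1 ω.2.1 := by
      funext p; simp [interp]
    simp only [pairWeight, h2, Fintype.sum_prod_type, cavFourth]
  simp only [hW]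
  exact sum_le_mul_integral_tilted (pairWeight_nonneg ω) (sum_pairWeight ω)
    (fun ρ => ovlpm_pow_four_nonneg ρ.1 ρ.2) (one_le_cavTilt N β 1)
    (fun a => (cavTilt_moment_one hN hβ ht a a a).1) (by positivity)
    (integral_cavTilt_le hN hβ ht)

/-- Conditionally on the cavity couplings, the cavity field changes the average of the squared
truncated overlap by at most a fourth-order quantity. -/
lemma abs_integral_tilted_ovlpm_sq_sub_le (hN : 0 < N) (hβ : β ∈ Set.Ioc (0 : ℝ) 1)
    (ht : t ∈ Set.Icc (0 : ℝ) 1)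
    (ω : (Fin N × Fin N → ℝ) × (Fin N × Fin N → ℝ) × (Fin N × Fin N → ℝ)) :
    |∫ ω', (∑ ρ, pairWeight N β t ω ρ * ovlpm N ρ.1 ρ.2 ^ 2 * cavTilt N β t ρ ω') /
          (∑ ρ, pairWeight N β t ω ρ * cavTilt N β t ρ ω') ∂disM3 N -
        ∑ ρ, pairWeight N β t ω ρ * ovlpm N ρ.1 ρ.2 ^ 2| ≤
      (3 + 4 * exp 1) * (exp 30 * 30 * 30) *
        (cavFourth N β (interp t ω.1 ω.2.1) + cavFourth N β (interp t ω.1 ω.2.2)) := by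
  refine (abs_integral_tilted_sub_le (f := fun ρ => ovlpm N ρ.1 ρ.2 ^ 2)
    (pairWeight_nonneg ω) (sum_pairWeight ω)
    (fun ρ => sq_nonneg _) (one_le_cavTilt N β t) (exp_pos (cavVar N β))
    (D := fun a b c => exp 30 * 30 * overlapSum ![a, b, c])
    (fun a => (cavTilt_moment_one hN hβ ht a a a).1)
    (fun a b => (cavTilt_moment_two hN hβ ht a b a).1)
    (fun a b c => (cavTilt_moment_three hN hβ ht a b c).1)
    (fun a b c => (cavTilt_moment_one hN hβ ht a b c).2)
    (fun a b c => (cavTilt_moment_two hN hβ ht a b c).2)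
    (cavTilt_moment_two_skip hN hβ ht)
    (fun a b c => (cavTilt_moment_three hN hβ ht a b c).2)).trans ?_
  set W := cavFourth N β (interp t ω.1 ω.2.1) + cavFourth N β (interp t ω.1 ω.2.2) with hW
  have hW0 : 0 ≤ W := add_nonneg (cavFourth_nonneg _) (cavFourth_nonneg _)
  set P := fun a b c => pairWeight N β t ω a * pairWeight N β t ω b * pairWeight N β t ω c with hP
  have hP0 : ∀ a b c, 0 ≤ P a b c := fun a b c => mul_nonneg
    (mul_nonneg (pairWeight_nonneg _ _) (pairWeight_nonneg _ _)) (pairWeight_nonneg _ _)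
  have hpair : ∀ p ∈ (univ : Finset (Fin 3 × Bool)).offDiag,
      ∑ a, ∑ b, ∑ c, P a b c * (ovlpm N a.1 a.2 ^ 2 *
        ovlpm N (replica ![a, b, c] p.1) (replica ![a, b, c] p.2) ^ 2) ≤ W := by
    intro p hp
    have h1 := sum_replica_ovlpm_pow_four_le (β := β) (t := t) ω (Finset.mem_offDiag.1 hp).2.2
    have h2 := sum_replica_ovlpm_pow_four_le (β := β) (t := t) ω
      (show ((0 : Fin 3), true) ≠ (0, false) by decide)
    have h3 : ∑ a, ∑ b, ∑ c, P a b c * (ovlpm N a.1 a.2 ^ 2 *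
        ovlpm N (replica ![a, b, c] p.1) (replica ![a, b, c] p.2) ^ 2) ≤
        ∑ a, ∑ b, ∑ c, (P a b c * ovlpm N (replica ![a, b, c] (0, true))
            (replica ![a, b, c] (0, false)) ^ 4 / 2 +
          P a b c * ovlpm N (replica ![a, b, c] p.1) (replica ![a, b, c] p.2) ^ 4 / 2) := by
      refine Finset.sum_le_sum fun a _ => Finset.sum_le_sum fun b _ => Finset.sum_le_sum
        fun c _ => ?_
      rw [← add_div, ← mul_add, mul_div_assoc]
      refine mul_le_mul_of_nonneg_left ?_ (hP0 a b c)
      have hr : ovlpm N (replica ![a, b, c] (0, true)) (replica ![a, b, c] (0, false)) =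
          ovlpm N a.1 a.2 := by simp [replica]
      rw [hr]
      nlinarith [sq_nonneg (ovlpm N a.1 a.2 ^ 2 -
        ovlpm N (replica ![a, b, c] p.1) (replica ![a, b, c] p.2) ^ 2)]
    simp only [Finset.sum_add_distrib, ← Finset.sum_div] at h3
    linarith
  have hsum : ∑ a, ∑ b, ∑ c, P a b c * (ovlpm N a.1 a.2 ^ 2 *
      (exp 30 * 30 * overlapSum ![a, b, c])) ≤ exp 30 * 30 * 30 * W := by
    have hcard : (univ : Finset (Fin 3 × Bool)).offDiag.card = 30 := by decide
    calc _ = exp 30 * 30 * ∑ p ∈ (univ : Finset (Fin 3 × Bool)).offDiag,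
          ∑ a, ∑ b, ∑ c, P a b c * (ovlpm N a.1 a.2 ^ 2 *
            ovlpm N (replica ![a, b, c] p.1) (replica ![a, b, c] p.2) ^ 2) := by
          rw [Finset.sum_comm (s := (univ : Finset (Fin 3 × Bool)).offDiag), Finset.mul_sum]
          refine Finset.sum_congr rfl fun a _ => ?_
          rw [Finset.sum_comm (s := (univ : Finset (Fin 3 × Bool)).offDiag), Finset.mul_sum]
          refine Finset.sum_congr rfl fun b _ => ?_
          rw [Finset.sum_comm (s := (univ : Finset (Fin 3 × Bool)).offDiag), Finset.mul_sum]
          refine Finset.sum_congr rfl fun c _ => ?_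
          rw [overlapSum, ← Finset.mul_sum, ← Finset.mul_sum]
          ring
      _ ≤ exp 30 * 30 * (30 * W) := by
          refine mul_le_mul_of_nonneg_left ?_ (by positivity)
          refine (Finset.sum_le_card_nsmul _ _ W hpair).trans_eq ?_
          rw [hcard]
          norm_num
      _ = _ := by ring
  calc _ ≤ (3 + 4 * exp (cavVar N β)) * (exp 30 * 30 * 30 * W) :=
        mul_le_mul_of_nonneg_left hsum (by positivity)
    _ ≤ (3 + 4 * exp 1) * (exp 30 * 30 * 30 * W) := by
        gcongr
        exact cavVar_le_one N hβ
    _ = _ := by ring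

lemma abs_EgibbsTS1_sub_le (hN : 0 < N) (hβ : β ∈ Set.Ioc (0 : ℝ) 1)
    (ht : t ∈ Set.Icc (0 : ℝ) 1) :
    |EgibbsTS1 N β t 1 (fun ρ => ovlpm N ρ.1 ρ.2 ^ 2) -
        EgibbsTS1 N β t 0 (fun ρ => ovlpm N ρ.1 ρ.2 ^ 2)| ≤
      (3 + 4 * exp 1) * (exp 30 * 30 * 30) * (2 * EcavFourth N β) := by
  obtain ⟨hi, he⟩ := EgibbsTS1_one (β := β) (t := t) hN
    (f := fun ρ => ovlpm N ρ.1 ρ.2 ^ 2) (fun σ τ => by simp only [ovlpm_flipLast_left])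
    (fun σ τ => by simp only [ovlpm_flipLast_right])
  have hi0 := integrable_gibbsTS1 (N := N) (β := β) (t := t) 0 (fun ρ => ovlpm N ρ.1 ρ.2 ^ 2)
  simp only [gibbsTS1_zero] at hi0
  obtain ⟨hi1, he1⟩ := cavFourth_interp_fst (N := N) (β := β) ht
  obtain ⟨hi2, he2⟩ := cavFourth_interp_snd (N := N) (β := β) ht
  rw [he, EgibbsTS1_zero, ← integral_sub hi hi0, two_mul]
  nth_rewrite 1 [← he1]
  rw [← he2, ← integral_add hi1 hi2, ← integral_const_mul]
  refine abs_integral_le_integral_abs.trans ?_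
  exact integral_mono (hi.sub' hi0).abs ((hi1.add hi2).const_mul _)
    (abs_integral_tilted_ovlpm_sq_sub_le hN hβ ht)

end Comparison

/-- `|E⟨R⁻(σ,τ)²⟩_t − E⟨R⁻(σ,τ)²⟩_{t,0}| ≤ K·E⟨R(σ¹,σ²)⁴⟩` with a
universal constant `K`. -/
theorem sk_truncated_overlap_comparison :
    ∃ K : ℝ, 0 < K ∧ ∀ N : ℕ, 1 ≤ N → ∀ β ∈ Set.Ioc (0 : ℝ) 1, ∀ t ∈ Set.Icc (0 : ℝ) 1,
      |EgibbsTS1 N β t 1 (fun ρ => ovlpm N ρ.1 ρ.2 ^ 2) -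
          EgibbsTS1 N β t 0 (fun ρ => ovlpm N ρ.1 ρ.2 ^ 2)| ≤
        K * Egibbs2 N β (fun σ τ => ovlp N σ τ ^ 4) := by
  refine ⟨(3 + 4 * exp 1) * (exp 30 * 30 * 30) *
    (2 * ((1 + exp 30 * 30 * 30) * exp 1 * 16)), by positivity, fun N hN β hβ t ht => ?_⟩
  calc _ ≤ (3 + 4 * exp 1) * (exp 30 * 30 * 30) * (2 * EcavFourth N β) :=
        abs_EgibbsTS1_sub_le hN hβ ht
    _ ≤ (3 + 4 * exp 1) * (exp 30 * 30 * 30) * (2 * ((1 + exp 30 * 30 * 30) * exp 1 *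
          (16 * Egibbs2 N β (fun σ τ => ovlp N σ τ ^ 4)))) := by
        have h := (EcavFourth_le hN hβ).trans
          (mul_le_mul_of_nonneg_left (EgibbsTS1_ovlpm_pow_four_le (β := β) hN) (by positivity))
        exact mul_le_mul_of_nonneg_left (mul_le_mul_of_nonneg_left h zero_le_two) (by positivity)
    _ = _ := by ring

end
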